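/- arXiv:1606.04776 — 7 statements merged into one kernel-verified Lean document; each statement's English description precedes it below -/
import Mathlib

section
/- Assume equation (1) satisfies Hypothesis (H) and that the functions S(\lambda_1,\cdot), \ldots, S(\lambda_m,\cdot) are not all identically zero on [0,1]. Then for each connected component U of \mathbb{R} \setminus \{\lambda_1,\ldots,\lambda_m\}, equation (1) has at most one periodic solution taking values in U, and every such periodic solution x is hyperbolic, i.e., \int_0^1 (\partial S/\partial x)(x(t),t)\,dt \ne 0. -/
open Set

/-- `x` is a periodic solution of `dx/dt = S(x,t)` on `[0,1]`. -/
def IsPeriodicSol (S : ℝ → ℝ → ℝ) (x : ℝ → ℝ) : Prop :=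
  (∀ t ∈ Set.Icc (0:ℝ) 1, HasDerivWithinAt x (S (x t) t) (Set.Icc (0:ℝ) 1) t) ∧ x 0 = x 1

open Polynomial in
/-- Lagrange interpolation in partial fraction form, for a polynomial whose degree may equal
the number of nodes. -/
theorem Polynomial.eval_eq_nodal_mul_of_natDegree_le {ι F : Type*} [DecidableEq ι] [Field F]
    {s : Finset ι} {v : ι → F} (hv : Set.InjOn v s) {p : F[X]} (hp : p.natDegree ≤ s.card)
    {x : F} (hx : ∀ i ∈ s, x ≠ v i) :
    p.eval x = (Lagrange.nodal s v).eval x *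
      (p.coeff s.card + ∑ i ∈ s, Lagrange.nodalWeight s v i * (x - v i)⁻¹ * p.eval (v i)) := by
  have hdeg : (p - C (p.coeff s.card) * Lagrange.nodal s v).degree < s.card := by
    rw [degree_lt_iff_coeff_zero]
    intro n hn
    rcases hn.eq_or_lt with rfl | hn
    · have h := (Lagrange.nodal_monic (s := s) (v := v)).coeff_natDegree
      rw [Lagrange.natDegree_nodal] at h
      simp [h]
    · have h1 : p.coeff n = 0 := coeff_eq_zero_of_natDegree_lt (hp.trans_lt hn)
      have h2 : (Lagrange.nodal s v).coeff n = 0 :=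
        coeff_eq_zero_of_natDegree_lt (by rwa [Lagrange.natDegree_nodal])
      simp [h1, h2]
  have h := congrArg (eval x) (Lagrange.eq_interpolate_of_eval_eq (fun i => p.eval (v i)) hv hdeg
    fun i hi => by simp [Lagrange.eval_nodal_at_node hi])
  rw [Lagrange.eval_interpolate_not_at_node _ hx, eval_sub, eval_mul, eval_C] at h
  linear_combination h

/-- The sign of the `i`-th nodal weight for increasing nodes indexed by `1, …, m`. -/
theorem neg_one_pow_mul_nodalWeight_pos {m : ℕ} {lam : ℕ → ℝ}
    (hlt : ∀ i j, 1 ≤ i → i < j → j ≤ m → lam i < lam j) {i : ℕ} (hi : i ∈ Finset.Icc 1 m) :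
    0 < (-1 : ℝ) ^ (m - i) * Lagrange.nodalWeight (Finset.Icc 1 m) lam i := by
  obtain ⟨hi1, him⟩ := Finset.mem_Icc.1 hi
  have hs : (Finset.Icc 1 m).erase i = Finset.Ico 1 i ∪ Finset.Ioc i m := by
    ext j
    simp only [Finset.mem_erase, Finset.mem_Icc, Finset.mem_union, Finset.mem_Ico, Finset.mem_Ioc]
    omega
  have hd : Disjoint (Finset.Ico 1 i) (Finset.Ioc i m) := by
    rw [Finset.disjoint_left]
    intro j
    simp only [Finset.mem_Ico, Finset.mem_Ioc]
    omega
  have hp : (-1 : ℝ) ^ (m - i) = ∏ _j ∈ Finset.Ioc i m, (-1 : ℝ) := by simp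
  rw [Lagrange.nodalWeight, hs, Finset.prod_union hd, hp, mul_left_comm, ← Finset.prod_mul_distrib]
  refine mul_pos (Finset.prod_pos fun j hj => ?_) (Finset.prod_pos fun j hj => ?_)
  · obtain ⟨h1, h2⟩ := Finset.mem_Ico.1 hj
    exact inv_pos.2 (sub_pos.2 (hlt j i h1 h2 him))
  · obtain ⟨h1, h2⟩ := Finset.mem_Ioc.1 hj
    rw [neg_one_mul, neg_pos]
    exact inv_lt_zero.2 (sub_neg.2 (hlt i j hi1 h1 h2))

/-- A solution of `d' = k d` is its initial value times an exponential. -/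
theorem exists_eq_mul_exp_of_hasDerivWithinAt {d k : ℝ → ℝ} (hk : ContinuousOn k (Icc 0 1))
    (hd : ∀ t ∈ Icc (0 : ℝ) 1, HasDerivWithinAt d (k t * d t) (Icc 0 1) t) :
    ∃ K : ℝ → ℝ, ∀ t ∈ Icc (0 : ℝ) 1, d t = d 0 * Real.exp (K t) := by
  set k' : ℝ → ℝ := IccExtend zero_le_one ((Icc (0 : ℝ) 1).domRestrict k) with hk'
  have hk'c : Continuous k' := hk.domRestrict.Icc_extend'
  have hkk : ∀ t ∈ Icc (0 : ℝ) 1, k' t = k t := fun t ht => by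
    rw [hk', IccExtend_of_mem _ _ ht, domRestrict_apply]
  refine ⟨fun t => ∫ s in (0 : ℝ)..t, k' s, fun t ht => ?_⟩
  set K : ℝ → ℝ := fun t => ∫ s in (0 : ℝ)..t, k' s with hK
  have hKd : ∀ t, HasDerivAt K (k' t) t := fun t => (hk'c.integral_hasStrictDerivAt 0 t).hasDerivAt
  have hder : ∀ t ∈ Icc (0 : ℝ) 1,
      HasDerivWithinAt (fun t => d t * Real.exp (-K t)) 0 (Icc 0 1) t := fun t ht => by
    refine ((hd t ht).fun_mul (hKd t).fun_neg.exp.hasDerivWithinAt).congr_deriv ?_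
    rw [hkk t ht]
    ring
  have h := constant_of_has_deriv_right_zero (fun t ht => (hder t ht).continuousWithinAt)
    (fun t ht => (hder t (Ico_subset_Icc_self ht)).mono_of_mem_nhdsWithin
      (Icc_mem_nhdsGE_of_mem ht)) t ht
  have h0 : K 0 = 0 := by simp [hK]
  simp only [h0, neg_zero, Real.exp_zero, mul_one] at h
  rw [← h, mul_assoc, ← Real.exp_add, neg_add_cancel, Real.exp_zero, mul_one]

theorem IsPeriodicSol.continuousOn {S : ℝ → ℝ → ℝ} {x : ℝ → ℝ} (hx : IsPeriodicSol S x) :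
    ContinuousOn x (Icc 0 1) := fun t ht => (hx.1 t ht).continuousWithinAt

theorem IsPeriodicSol.integral_comp_mul_eq_zero {S : ℝ → ℝ → ℝ} {x g : ℝ → ℝ}
    (hx : IsPeriodicSol S x) (hS : ContinuousOn (fun t => S (x t) t) (Icc 0 1))
    (hg : ContinuousOn g (x '' Icc 0 1)) : ∫ t in (0 : ℝ)..1, g (x t) * S (x t) t = 0 := by
  have hI : uIcc (0 : ℝ) 1 = Icc 0 1 := uIcc_of_le zero_le_one
  have h := intervalIntegral.integral_comp_mul_deriv'' (a := 0) (b := 1) (f := x)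
    (f' := fun t => S (x t) t) (g := g) (by rw [hI]; exact hx.continuousOn)
    (fun t ht => by
      rw [min_eq_left zero_le_one, max_eq_right zero_le_one] at ht
      exact (hx.1 t (Ioo_subset_Icc_self ht)).mono_of_mem_nhdsWithin
        (Icc_mem_nhdsGT_of_mem (Ioo_subset_Ico_self ht)))
    (by rwa [hI]) (by rwa [hI])
  rw [hx.2, intervalIntegral.integral_same] at h
  exact h

/-- A combination with positive continuous coefficients of continuous functions of one common sign
which do not all vanish identically has nonzero integral. -/
theorem integral_sum_mul_ne_zero {ι : Type*} {s : Finset ι} {b q : ι → ℝ → ℝ} {σ : ℝ}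
    (hb : ∀ i ∈ s, ContinuousOn (b i) (Icc 0 1)) (hq : ∀ i ∈ s, ContinuousOn (q i) (Icc 0 1))
    (hσ : σ ≠ 0) (hσb : ∀ i ∈ s, ∀ t ∈ Icc (0 : ℝ) 1, 0 ≤ σ * b i t)
    (hqpos : ∀ i ∈ s, ∀ t ∈ Icc (0 : ℝ) 1, 0 < q i t)
    (hne : ∃ i ∈ s, ∃ t ∈ Icc (0 : ℝ) 1, b i t ≠ 0) :
    ∫ t in (0 : ℝ)..1, ∑ i ∈ s, b i t * q i t ≠ 0 := by
  have hnonneg : ∀ t ∈ Icc (0 : ℝ) 1, ∀ i ∈ s, 0 ≤ σ * (b i t * q i t) := fun t ht i hi => by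
    rw [← mul_assoc]
    exact mul_nonneg (hσb i hi t ht) (hqpos i hi t ht).le
  have h : 0 < ∫ t in (0 : ℝ)..1, σ * ∑ i ∈ s, b i t * q i t := by
    refine intervalIntegral.integral_pos zero_lt_one ?_ (fun t ht => ?_) ?_
    · exact continuousOn_const.mul (continuousOn_finsetSum _ fun i hi => (hb i hi).mul (hq i hi))
    · rw [Finset.mul_sum]
      exact Finset.sum_nonneg (hnonneg t (Ioc_subset_Icc_self ht))
    · obtain ⟨i, hi, t, ht, hbt⟩ := hne
      refine ⟨t, ht, ?_⟩
      rw [Finset.mul_sum]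
      refine Finset.sum_pos' (hnonneg t ht) ⟨i, hi, (hnonneg t ht i hi).lt_of_ne' ?_⟩
      exact mul_ne_zero hσ (mul_ne_zero hbt (hqpos i hi t ht).ne')
  rw [intervalIntegral.integral_const_mul] at h
  exact right_ne_zero_of_mul h.ne'

/-- Two periodic solutions of a polynomial equation coincide if they agree at time `0`; otherwise
they are strictly ordered with the order independent of time. -/
theorem IsPeriodicSol.exists_sub_eq_mul_exp {S : ℝ → ℝ → ℝ} {n : ℕ} {a : ℕ → ℝ → ℝ}
    (hS : ∀ x t, S x t = ∑ i ∈ Finset.range n, a i t * x ^ i)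
    (ha : ∀ i ∈ Finset.range n, ContinuousOn (a i) (Icc 0 1)) {x y : ℝ → ℝ}
    (hx : IsPeriodicSol S x) (hy : IsPeriodicSol S y) :
    ∃ K : ℝ → ℝ, ∀ t ∈ Icc (0 : ℝ) 1, y t - x t = (y 0 - x 0) * Real.exp (K t) := by
  refine exists_eq_mul_exp_of_hasDerivWithinAt (d := fun t => y t - x t)
    (k := fun t => ∑ i ∈ Finset.range n,
      a i t * ∑ j ∈ Finset.range i, y t ^ j * x t ^ (i - 1 - j)) ?_ fun t ht => ?_
  · exact continuousOn_finsetSum _ fun i hi => (ha i hi).mul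
      (continuousOn_finsetSum _ fun j _ => (hy.continuousOn.pow _).mul (hx.continuousOn.pow _))
  · refine ((hy.1 t ht).fun_sub (hx.1 t ht)).congr_deriv ?_
    simp only [hS, Finset.sum_mul, ← Finset.sum_sub_distrib]
    refine Finset.sum_congr rfl fun i _ => ?_
    rw [← mul_sub, ← geom_sum₂_mul, mul_assoc]

section PartialFractions

variable {S : ℝ → ℝ → ℝ} {s : Finset ℕ} {v : ℕ → ℝ} {b : ℕ → ℝ → ℝ} {c : ℝ → ℝ} {U : Set ℝ}
  {σ : ℝ}

theorem ne_node_of_sub_mul_sub_pos (hU : ∀ p ∈ U, ∀ q ∈ U, ∀ i ∈ s, 0 < (p - v i) * (q - v i))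
    {p : ℝ} (hp : p ∈ U) : ∀ i ∈ s, p ≠ v i := fun i hi h => by
  simpa [h] using hU p hp p hp i hi

/-- If `S` divided by the nodal polynomial is a sum of partial fractions whose coefficients have
a common sign, there are no two ordered periodic solutions on the same side of every node. -/
theorem IsPeriodicSol.not_forall_lt
    (hU : ∀ p ∈ U, ∀ q ∈ U, ∀ i ∈ s, 0 < (p - v i) * (q - v i))
    (hSc : ∀ x : ℝ → ℝ, ContinuousOn x (Icc 0 1) → ContinuousOn (fun t => S (x t) t) (Icc 0 1))
    (hpf : ∀ x t, (∀ i ∈ s, x ≠ v i) →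
      S x t = (Lagrange.nodal s v).eval x * (c t + ∑ i ∈ s, b i t * (x - v i)⁻¹))
    (hb : ∀ i ∈ s, ContinuousOn (b i) (Icc 0 1)) (hσ : σ ≠ 0)
    (hσb : ∀ i ∈ s, ∀ t ∈ Icc (0 : ℝ) 1, 0 ≤ σ * b i t)
    (hne : ∃ i ∈ s, ∃ t ∈ Icc (0 : ℝ) 1, b i t ≠ 0) {x y : ℝ → ℝ}
    (hx : IsPeriodicSol S x) (hxU : ∀ t ∈ Icc (0 : ℝ) 1, x t ∈ U)
    (hy : IsPeriodicSol S y) (hyU : ∀ t ∈ Icc (0 : ℝ) 1, y t ∈ U) :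
    ¬ ∀ t ∈ Icc (0 : ℝ) 1, x t < y t := by
  intro hxy
  have key : ∀ z : ℝ → ℝ, IsPeriodicSol S z → (∀ t ∈ Icc (0 : ℝ) 1, z t ∈ U) →
      ContinuousOn (fun t => ((Lagrange.nodal s v).eval (z t))⁻¹ * S (z t) t) (Icc 0 1) ∧
      ∫ t in (0 : ℝ)..1, ((Lagrange.nodal s v).eval (z t))⁻¹ * S (z t) t = 0 := by
    intro z hz hzU
    have hg : ContinuousOn (fun p => ((Lagrange.nodal s v).eval p)⁻¹) (z '' Icc 0 1) := by
      refine (Polynomial.continuousOn _).inv₀ ?_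
      rintro _ ⟨t, ht, rfl⟩
      exact Lagrange.eval_nodal_not_at_node (ne_node_of_sub_mul_sub_pos hU (hzU t ht))
    exact ⟨(hg.comp hz.continuousOn (mapsTo_image _ _)).mul (hSc z hz.continuousOn),
      hz.integral_comp_mul_eq_zero (hSc z hz.continuousOn) hg⟩
  obtain ⟨hxc, hxi⟩ := key x hx hxU
  obtain ⟨hyc, hyi⟩ := key y hy hyU
  have hxn : ∀ t ∈ Icc (0 : ℝ) 1, ∀ i ∈ s, x t - v i ≠ 0 := fun t ht i hi =>
    sub_ne_zero.2 (ne_node_of_sub_mul_sub_pos hU (hxU t ht) i hi)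
  have hyn : ∀ t ∈ Icc (0 : ℝ) 1, ∀ i ∈ s, y t - v i ≠ 0 := fun t ht i hi =>
    sub_ne_zero.2 (ne_node_of_sub_mul_sub_pos hU (hyU t ht) i hi)
  refine integral_sum_mul_ne_zero (q := fun i t => (y t - x t) / ((x t - v i) * (y t - v i)))
    hb (fun i hi => ?_) hσ hσb (fun i hi t ht => ?_) hne ?_
  · exact (hy.continuousOn.sub hx.continuousOn).div
      ((hx.continuousOn.sub continuousOn_const).mul (hy.continuousOn.sub continuousOn_const))
      fun t ht => mul_ne_zero (hxn t ht i hi) (hyn t ht i hi)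
  · exact div_pos (sub_pos.2 (hxy t ht)) (hU _ (hxU t ht) _ (hyU t ht) i hi)
  · have hsub := intervalIntegral.integral_sub
      (hxc.intervalIntegrable_of_Icc (μ := MeasureTheory.volume) zero_le_one)
      (hyc.intervalIntegrable_of_Icc zero_le_one)
    rw [hxi, hyi, sub_zero] at hsub
    refine Eq.trans ?_ hsub
    refine intervalIntegral.integral_congr fun t ht => ?_
    rw [uIcc_of_le zero_le_one] at ht
    have hxU' := ne_node_of_sub_mul_sub_pos hU (hxU t ht)
    have hyU' := ne_node_of_sub_mul_sub_pos hU (hyU t ht)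
    rw [hpf _ t hxU', hpf _ t hyU', inv_mul_cancel_left₀ (Lagrange.eval_nodal_not_at_node hxU'),
      inv_mul_cancel_left₀ (Lagrange.eval_nodal_not_at_node hyU'), add_sub_add_left_eq_sub,
      ← Finset.sum_sub_distrib]
    refine Finset.sum_congr rfl fun i hi => ?_
    have h1 := hxn t ht i hi
    have h2 := hyn t ht i hi
    field_simp
    ring

/-- If `S` divided by the nodal polynomial is a sum of partial fractions whose coefficients have
a common sign, periodic solutions avoiding the nodes are hyperbolic. -/
theorem IsPeriodicSol.integral_deriv_ne_zero
    (hU : ∀ p ∈ U, ∀ q ∈ U, ∀ i ∈ s, 0 < (p - v i) * (q - v i))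
    (hSc : ∀ x : ℝ → ℝ, ContinuousOn x (Icc 0 1) → ContinuousOn (fun t => S (x t) t) (Icc 0 1))
    (hpf : ∀ x t, (∀ i ∈ s, x ≠ v i) →
      S x t = (Lagrange.nodal s v).eval x * (c t + ∑ i ∈ s, b i t * (x - v i)⁻¹))
    (hb : ∀ i ∈ s, ContinuousOn (b i) (Icc 0 1)) (hσ : σ ≠ 0)
    (hσb : ∀ i ∈ s, ∀ t ∈ Icc (0 : ℝ) 1, 0 ≤ σ * b i t)
    (hne : ∃ i ∈ s, ∃ t ∈ Icc (0 : ℝ) 1, b i t ≠ 0) {x : ℝ → ℝ}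
    (hx : IsPeriodicSol S x) (hxU : ∀ t ∈ Icc (0 : ℝ) 1, x t ∈ U) :
    ∫ t in (0 : ℝ)..1, deriv (fun y => S y t) (x t) ≠ 0 := by
  set W := Lagrange.nodal s v with hW
  have hxn := fun t ht => ne_node_of_sub_mul_sub_pos hU (hxU t ht)
  have hWx : ∀ t ∈ Icc (0 : ℝ) 1, W.eval (x t) ≠ 0 := fun t ht =>
    Lagrange.eval_nodal_not_at_node (hxn t ht)
  have h01 : (0 : ℝ) ∈ Icc (0 : ℝ) 1 := left_mem_Icc.2 zero_le_one
  have hWc : ContinuousOn (fun t => W.eval (x t)) (Icc 0 1) :=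
    W.continuous.comp_continuousOn hx.continuousOn
  have hg : ContinuousOn (fun p => W.derivative.eval p / W.eval p) (x '' Icc 0 1) := by
    refine (Polynomial.continuousOn _).div (Polynomial.continuousOn _) ?_
    rintro _ ⟨t, ht, rfl⟩
    exact hWx t ht
  have hlog := hx.integral_comp_mul_eq_zero (hSc x hx.continuousOn) hg
  have hlogc : ContinuousOn (fun t => W.derivative.eval (x t) / W.eval (x t) * S (x t) t)
      (Icc 0 1) :=
    (hg.comp hx.continuousOn (mapsTo_image _ _)).mul (hSc x hx.continuousOn)
  have hqc : ∀ i ∈ s, ContinuousOn (fun t => W.eval (x t) * W.eval (x 0) / (x t - v i) ^ 2)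
      (Icc 0 1) := fun i hi =>
    (hWc.mul continuousOn_const).div ((hx.continuousOn.sub continuousOn_const).pow 2)
      fun t ht => pow_ne_zero _ (sub_ne_zero.2 (hxn t ht i hi))
  have hpos := integral_sum_mul_ne_zero hb hqc hσ hσb (fun i hi t ht => by
    refine div_pos ?_ (pow_two_pos_of_ne_zero (sub_ne_zero.2 (hxn t ht i hi)))
    rw [hW, Lagrange.eval_nodal, Lagrange.eval_nodal, ← Finset.prod_mul_distrib]
    exact Finset.prod_pos fun j hj => hU _ (hxU t ht) _ (hxU 0 h01) j hj) hne
  have hsumc : ContinuousOn (fun t => ∑ i ∈ s,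
      b i t * (W.eval (x t) * W.eval (x 0) / (x t - v i) ^ 2)) (Icc 0 1) :=
    continuousOn_finsetSum _ fun i hi => (hb i hi).mul (hqc i hi)
  have hderiv : ∀ t ∈ Icc (0 : ℝ) 1, deriv (fun y => S y t) (x t) =
      W.derivative.eval (x t) / W.eval (x t) * S (x t) t -
        (W.eval (x 0))⁻¹ *
          ∑ i ∈ s, b i t * (W.eval (x t) * W.eval (x 0) / (x t - v i) ^ 2) := by
    intro t ht
    have heq : (fun y => S y t) =ᶠ[nhds (x t)]
        fun y => W.eval y * (c t + ∑ i ∈ s, b i t * (y - v i)⁻¹) := by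
      filter_upwards [W.continuous.continuousAt.eventually_ne (hWx t ht)] with y hy
      refine hpf y t fun i hi h => hy ?_
      rw [h, hW, Lagrange.eval_nodal_at_node hi]
    have hd : HasDerivAt (fun y => c t + ∑ i ∈ s, b i t * (y - v i)⁻¹)
        (∑ i ∈ s, b i t * (-1 / (x t - v i) ^ 2)) (x t) :=
      (HasDerivAt.fun_sum fun i hi => (((hasDerivAt_id (x t)).sub_const (v i)).fun_inv
        (sub_ne_zero.2 (hxn t ht i hi))).const_mul (b i t)).const_add (c t)
    rw [heq.deriv_eq, ((W.hasDerivAt (x t)).fun_mul hd).deriv, hpf _ t (hxn t ht),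
      ← mul_assoc, div_mul_cancel₀ _ (hWx t ht), sub_eq_add_neg, Finset.mul_sum, Finset.mul_sum,
      ← Finset.sum_neg_distrib]
    congr 1
    refine Finset.sum_congr rfl fun i hi => ?_
    have h0 := hWx 0 h01
    field_simp
  rw [intervalIntegral.integral_congr (g := fun t =>
      W.derivative.eval (x t) / W.eval (x t) * S (x t) t - (W.eval (x 0))⁻¹ *
        ∑ i ∈ s, b i t * (W.eval (x t) * W.eval (x 0) / (x t - v i) ^ 2))
      fun t ht => hderiv t (by rwa [uIcc_of_le zero_le_one] at ht),
    intervalIntegral.integral_sub (hlogc.intervalIntegrable_of_Icc zero_le_one)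
      ((hsumc.intervalIntegrable_of_Icc zero_le_one).const_mul _),
    hlog, zero_sub, intervalIntegral.integral_const_mul, neg_ne_zero]
  exact mul_ne_zero (inv_ne_zero (hWx 0 h01)) hpos

end PartialFractions

/-- Proposition 2.2 (i): under Hypothesis (H) with `S(λ₁,·), …, S(λ_m,·)` not all
identically zero, each connected component of `ℝ \ {λ₁,…,λ_m}` contains at most one
periodic solution, and every such periodic solution is hyperbolic. -/
theorem abel_component_at_most_one (m : ℕ) (hm : 1 ≤ m) (a : ℕ → ℝ → ℝ)
    (ha : ∀ i ≤ m, ContDiffOn ℝ (⊤ : ℕ∞) (a i) (Set.Icc (0:ℝ) 1))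
    (S : ℝ → ℝ → ℝ)
    (hS : ∀ x t, S x t = ∑ i ∈ Finset.range (m + 1), a i t * x ^ i)
    (lam : ℕ → ℝ)
    (hlt : ∀ i j, 1 ≤ i → i < j → j ≤ m → lam i < lam j)
    (hsign : (∀ i, 1 ≤ i → i ≤ m → ∀ t ∈ Set.Icc (0:ℝ) 1, 0 ≤ (-1:ℝ) ^ i * S (lam i) t) ∨
             (∀ i, 1 ≤ i → i ≤ m → ∀ t ∈ Set.Icc (0:ℝ) 1, (-1:ℝ) ^ i * S (lam i) t ≤ 0))
    (hnotall : ¬ ∀ i, 1 ≤ i → i ≤ m → ∀ t ∈ Set.Icc (0:ℝ) 1, S (lam i) t = 0) :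
    ∀ U : Set ℝ,
      (U = Set.Iio (lam 1) ∨ U = Set.Ioi (lam m) ∨
        ∃ i, 1 ≤ i ∧ i < m ∧ U = Set.Ioo (lam i) (lam (i + 1))) →
      (∀ x y : ℝ → ℝ, IsPeriodicSol S x → (∀ t ∈ Set.Icc (0:ℝ) 1, x t ∈ U) →
        IsPeriodicSol S y → (∀ t ∈ Set.Icc (0:ℝ) 1, y t ∈ U) →
        ∀ t ∈ Set.Icc (0:ℝ) 1, x t = y t) ∧
      (∀ x : ℝ → ℝ, IsPeriodicSol S x → (∀ t ∈ Set.Icc (0:ℝ) 1, x t ∈ U) →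
        (∫ t in (0:ℝ)..1, deriv (fun y => S y t) (x t)) ≠ 0) := by
  have hle : ∀ i j, 1 ≤ i → i ≤ j → j ≤ m → lam i ≤ lam j := fun i j h1 hij hj =>
    hij.eq_or_lt.elim (fun h => h ▸ le_rfl) fun h => (hlt i j h1 h hj).le
  have hinj : Set.InjOn lam (Finset.Icc 1 m) :=
    StrictMonoOn.injOn fun i hi j hj hij =>
      hlt i j (Finset.mem_Icc.1 hi).1 hij (Finset.mem_Icc.1 hj).2
  have hac : ∀ i ∈ Finset.range (m + 1), ContinuousOn (a i) (Icc 0 1) := fun i hi =>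
    (ha i (Nat.lt_succ_iff.1 (Finset.mem_range.1 hi))).continuousOn
  have hSc : ∀ x : ℝ → ℝ, ContinuousOn x (Icc 0 1) →
      ContinuousOn (fun t => S (x t) t) (Icc 0 1) := fun x hx => by
    simp only [hS]
    exact continuousOn_finsetSum _ fun i hi => (hac i hi).mul (hx.pow i)
  set w := Lagrange.nodalWeight (Finset.Icc 1 m) lam with hw
  set b : ℕ → ℝ → ℝ := fun i t => w i * S (lam i) t with hbdef
  have hb : ∀ i ∈ Finset.Icc 1 m, ContinuousOn (b i) (Icc 0 1) := fun i _ =>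
    continuousOn_const.mul (hSc (fun _ => lam i) continuousOn_const)
  have hwne : ∀ i ∈ Finset.Icc 1 m, w i ≠ 0 := fun i hi => Lagrange.nodalWeight_ne_zero hinj hi
  have hne : ∃ i ∈ Finset.Icc 1 m, ∃ t ∈ Icc (0 : ℝ) 1, b i t ≠ 0 := by
    push Not at hnotall
    obtain ⟨i, h1, him, t, ht, h⟩ := hnotall
    have hi := Finset.mem_Icc.2 ⟨h1, him⟩
    exact ⟨i, hi, t, ht, mul_ne_zero (hwne i hi) h⟩
  have hbeq : ∀ i ∈ Finset.Icc 1 m, ∀ t,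
      (-1 : ℝ) ^ m * b i t = ((-1) ^ (m - i) * w i) * ((-1) ^ i * S (lam i) t) := by
    intro i hi t
    have hm' : (-1 : ℝ) ^ m = (-1) ^ (m - i) * (-1) ^ i := by
      rw [← pow_add, Nat.sub_add_cancel (Finset.mem_Icc.1 hi).2]
    rw [hm', hbdef]
    ring
  obtain ⟨σ, hσ, hσb⟩ : ∃ σ : ℝ, σ ≠ 0 ∧
      ∀ i ∈ Finset.Icc 1 m, ∀ t ∈ Icc (0 : ℝ) 1, 0 ≤ σ * b i t := by
    rcases hsign with h | h
    · refine ⟨(-1) ^ m, by simp, fun i hi t ht => ?_⟩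
      obtain ⟨h1, h2⟩ := Finset.mem_Icc.1 hi
      rw [hbeq i hi]
      exact mul_nonneg (neg_one_pow_mul_nodalWeight_pos hlt hi).le (h i h1 h2 t ht)
    · refine ⟨-(-1) ^ m, by simp, fun i hi t ht => ?_⟩
      obtain ⟨h1, h2⟩ := Finset.mem_Icc.1 hi
      rw [neg_mul, hbeq i hi, neg_nonneg]
      exact mul_nonpos_of_nonneg_of_nonpos (neg_one_pow_mul_nodalWeight_pos hlt hi).le
        (h i h1 h2 t ht)
  have hpf : ∀ x t, (∀ i ∈ Finset.Icc 1 m, x ≠ lam i) →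
      S x t = (Lagrange.nodal (Finset.Icc 1 m) lam).eval x *
        (a m t + ∑ i ∈ Finset.Icc 1 m, b i t * (x - lam i)⁻¹) := by
    intro x t hx
    set p : Polynomial ℝ :=
      ∑ i ∈ Finset.range (m + 1), Polynomial.C (a i t) * Polynomial.X ^ i with hp
    have hpe : ∀ y, p.eval y = S y t := fun y => by simp [hp, hS, Polynomial.eval_finsetSum]
    have hcard : (Finset.Icc 1 m).card = m := by simp
    have hdeg : p.natDegree ≤ (Finset.Icc 1 m).card := by
      rw [hcard]
      refine Polynomial.natDegree_sum_le_of_forall_le _ _ fun i hi => ?_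
      exact (Polynomial.natDegree_C_mul_X_pow_le _ _).trans
        (Nat.lt_succ_iff.1 (Finset.mem_range.1 hi))
    have hcoeff : p.coeff m = a m t := by
      simp [hp, Polynomial.coeff_X_pow]
    rw [← hpe, Polynomial.eval_eq_nodal_mul_of_natDegree_le hinj hdeg hx, hcard, hcoeff]
    congr 2
    refine Finset.sum_congr rfl fun i _ => ?_
    rw [hpe, hbdef]
    ring
  intro U hUcases
  have hU : ∀ p ∈ U, ∀ q ∈ U, ∀ i ∈ Finset.Icc 1 m, 0 < (p - lam i) * (q - lam i) := by
    intro p hp q hq i hi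
    obtain ⟨h1, him⟩ := Finset.mem_Icc.1 hi
    rcases hUcases with rfl | rfl | ⟨j, hj1, hjm, rfl⟩
    · have h := hle 1 i le_rfl h1 him
      exact mul_pos_of_neg_of_neg (sub_neg.2 (lt_of_lt_of_le hp h))
        (sub_neg.2 (lt_of_lt_of_le hq h))
    · have h := hle i m h1 him le_rfl
      exact mul_pos (sub_pos.2 (lt_of_le_of_lt h hp)) (sub_pos.2 (lt_of_le_of_lt h hq))
    · rcases Nat.lt_or_ge j i with hji | hij
      · have h := hle (j + 1) i (Nat.le_add_left 1 j) hji him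
        exact mul_pos_of_neg_of_neg (sub_neg.2 (hp.2.trans_le h)) (sub_neg.2 (hq.2.trans_le h))
      · have h := hle i j h1 hij hjm.le
        exact mul_pos (sub_pos.2 (h.trans_lt hp.1)) (sub_pos.2 (h.trans_lt hq.1))
  refine ⟨fun x y hx hxU hy hyU => ?_, fun x hx hxU =>
    hx.integral_deriv_ne_zero hU hSc hpf hb hσ hσb hne hxU⟩
  obtain ⟨K, hK⟩ := hx.exists_sub_eq_mul_exp hS hac hy
  rcases lt_trichotomy (x 0) (y 0) with h | h | h
  · refine absurd (fun t ht => sub_pos.1 ?_)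
      (hx.not_forall_lt hU hSc hpf hb hσ hσb hne hxU hy hyU)
    rw [hK t ht]
    exact mul_pos (sub_pos.2 h) (Real.exp_pos _)
  · intro t ht
    have := hK t ht
    rw [h, sub_self, zero_mul] at this
    exact (sub_eq_zero.1 this).symm
  · refine absurd (fun t ht => sub_neg.1 ?_)
      (hy.not_forall_lt hU hSc hpf hb hσ hσb hne hyU hx hxU)
    rw [hK t ht]
    exact mul_neg_of_neg_of_pos (sub_neg.2 h) (Real.exp_pos _)
end

section
/- Assume equation (1) satisfies Hypothesis (H), the functions S(\lambda_1,\cdot), \ldots, S(\lambda_m,\cdot) are not all identically zero, and \lambda \in \{\lambda_1,\ldots,\lambda_m\} satisfies S(\lambda,t) = 0 for all t \in [0,1]. Let U_1 and U_2 be the two connected components of \mathbb{R} \setminus \{\lambda_1,\ldots,\lambda_m\} adjacent to the point \lambda. Then at least one of U_1, U_2 contains no periodic solution of (1) (i.e., no periodic solution takes all its values in that component). -/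
open Set

/-- Over increasing nodes, the nodal weights alternate in sign. -/
theorem nodalWeight_Icc_alternating_pos {m : ℕ} {v : ℕ → ℝ}
    (hv : ∀ i j, 1 ≤ i → i < j → j ≤ m → v i < v j) {i : ℕ} (hi : i ∈ Finset.Icc 1 m) :
    0 < (-1 : ℝ) ^ (m + i) * Lagrange.nodalWeight (Finset.Icc 1 m) v i := by
  obtain ⟨hi1, him⟩ := Finset.mem_Icc.1 hi
  have hcard : (-1 : ℝ) ^ (m + i) =
      ∏ j ∈ (Finset.Icc 1 m).erase i, if i < j then (-1 : ℝ) else 1 := by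
    have hfilter : ((Finset.Icc 1 m).erase i).filter (i < ·) = Finset.Ioc i m := by
      ext j
      simp only [Finset.mem_filter, Finset.mem_erase, Finset.mem_Icc, Finset.mem_Ioc]
      omega
    rw [Finset.prod_ite, hfilter, Finset.prod_const, Finset.prod_const_one, mul_one, Nat.card_Ioc,
      show m + i = m - i + 2 * i by omega, pow_add, pow_mul]
    simp
  rw [hcard, Lagrange.nodalWeight, ← Finset.prod_mul_distrib]
  refine Finset.prod_pos fun j hj ↦ ?_
  obtain ⟨hji, hj⟩ := Finset.mem_erase.1 hj
  obtain ⟨hj1, hjm⟩ := Finset.mem_Icc.1 hj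
  split_ifs with h
  · have := inv_neg''.2 (sub_neg.2 (hv i j hi1 h hjm))
    linarith
  · have := inv_pos.2 (sub_pos.2 (hv j i hj1 (by omega) him))
    linarith

/-- Partial fraction decomposition of the reciprocal of the nodal polynomial. -/
theorem nodal_mul_sum_nodalWeight {ι F : Type*} [DecidableEq ι] [Field F] {s : Finset ι}
    {v : ι → F} (hv : Set.InjOn v s) (hs : s.Nonempty) {y : F} (hy : ∀ i ∈ s, y ≠ v i) :
    (Lagrange.nodal s v).eval y * ∑ i ∈ s, Lagrange.nodalWeight s v i * (y - v i)⁻¹ = 1 := by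
  have h := Lagrange.eval_interpolate_not_at_node (s := s) (v := v) 1 hy
  rw [Lagrange.interpolate_one hv hs] at h
  simpa using h.symm

/-- Partial fraction decomposition of a polynomial of degree at most `#s` divided by the nodal
polynomial of `s`. -/
theorem sum_nodalWeight_mul_eval {F : Type*} [Field F] {m : ℕ} (hm : 1 ≤ m) {v : ℕ → F}
    (hv : Set.InjOn v (Finset.Icc 1 m)) (c : ℕ → F) {y : F}
    (hy : ∀ i ∈ Finset.Icc 1 m, y ≠ v i) :
    (∑ i ∈ Finset.Icc 1 m, Lagrange.nodalWeight (Finset.Icc 1 m) v i * (y - v i)⁻¹) *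
        ∑ j ∈ Finset.range (m + 1), c j * y ^ j =
      c m + ∑ i ∈ Finset.Icc 1 m, Lagrange.nodalWeight (Finset.Icc 1 m) v i * (y - v i)⁻¹ *
        ∑ j ∈ Finset.range (m + 1), c j * v i ^ j := by
  set s := Finset.Icc 1 m with hs
  have hcard : s.card = m := by simp [hs]
  set q : Polynomial F := (∑ j ∈ Finset.range m, Polynomial.C (c j) * Polynomial.X ^ j) +
    Polynomial.C (c m) * (Polynomial.X ^ m - Lagrange.nodal s v) with hq
  have hnodal : (Polynomial.X ^ m - Lagrange.nodal s v : Polynomial F).degree < m := by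
    have hdeg : (Lagrange.nodal s v).degree = m := by rw [Lagrange.degree_nodal, hcard]
    have := Polynomial.degree_sub_lt_left (p := (Polynomial.X ^ m : Polynomial F))
      (q := Lagrange.nodal s v) (by rw [hdeg, Polynomial.degree_X_pow])
      (pow_ne_zero _ Polynomial.X_ne_zero)
      (by rw [(Polynomial.monic_X_pow m).leadingCoeff, Lagrange.nodal_monic.leadingCoeff])
    rwa [Polynomial.degree_X_pow] at this
  have hdeg : q.degree < s.card := by
    rw [hcard, hq]
    refine (Polynomial.degree_add_le _ _).trans_lt (max_lt ?_ ?_)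
    · refine (Polynomial.degree_sum_le _ _).trans_lt ?_
      rw [Finset.sup_lt_iff (by simp)]
      intro j hj
      exact (Polynomial.degree_C_mul_X_pow_le _ _).trans_lt
        (by exact_mod_cast Finset.mem_range.1 hj)
    · rw [← Polynomial.smul_eq_C_mul]
      exact (Polynomial.degree_smul_le _ _).trans_lt hnodal
  have heval (z : F) : q.eval z = (∑ j ∈ Finset.range (m + 1), c j * z ^ j) -
      c m * (Lagrange.nodal s v).eval z := by
    rw [hq, Finset.sum_range_succ]
    simp only [Polynomial.eval_add, Polynomial.eval_finsetSum, Polynomial.eval_mul,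
      Polynomial.eval_C, Polynomial.eval_pow, Polynomial.eval_X, Polynomial.eval_sub]
    ring
  have hinter := congrArg (Polynomial.eval y) (Lagrange.eq_interpolate hv hdeg)
  rw [Lagrange.eval_interpolate_not_at_node _ hy, heval] at hinter
  have hnode : ∀ i ∈ s, q.eval (v i) = ∑ j ∈ Finset.range (m + 1), c j * v i ^ j := by
    intro i hi
    rw [heval, Lagrange.eval_nodal_at_node hi, mul_zero, sub_zero]
  have hsum : ∑ i ∈ s, Lagrange.nodalWeight s v i * (y - v i)⁻¹ * q.eval (v i) =
      ∑ i ∈ s, Lagrange.nodalWeight s v i * (y - v i)⁻¹ *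
        ∑ j ∈ Finset.range (m + 1), c j * v i ^ j :=
    Finset.sum_congr rfl fun i hi ↦ by rw [hnode i hi]
  rw [hsum] at hinter
  have hone := nodal_mul_sum_nodalWeight hv ⟨1, by simp [hs, hm]⟩ hy
  rw [sub_eq_iff_eq_add.1 hinter]
  linear_combination (c m + ∑ i ∈ s, Lagrange.nodalWeight s v i * (y - v i)⁻¹ *
    ∑ j ∈ Finset.range (m + 1), c j * v i ^ j) * hone

/-- A function on `[a, b]` with nonnegative derivative and equal endpoint values has zero
derivative. -/
theorem eq_zero_of_hasDerivWithinAt_nonneg {f f' : ℝ → ℝ} {a b : ℝ} (hab : a < b)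
    (hf : ∀ t ∈ Icc a b, HasDerivWithinAt f (f' t) (Icc a b) t)
    (hf' : ∀ t ∈ Icc a b, 0 ≤ f' t) (heq : f a = f b) : ∀ t ∈ Icc a b, f' t = 0 := by
  have hmono : MonotoneOn f (Icc a b) := by
    refine monotoneOn_of_hasDerivWithinAt_nonneg (convex_Icc a b)
      (fun t ht ↦ (hf t ht).continuousWithinAt) (f' := f')
      (fun t ht ↦ (hf t (interior_subset ht)).mono interior_subset)
      (fun t ht ↦ hf' t (interior_subset ht))
  intro t ht
  have hconst : ∀ s ∈ Icc a b, f s = f a := fun s hs ↦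
    le_antisymm (heq ▸ hmono hs (right_mem_Icc.2 hab.le) hs.2)
      (hmono (left_mem_Icc.2 hab.le) hs hs.1)
  have h := (hasDerivWithinAt_const t (Icc a b) (f a)).congr hconst (hconst t ht)
  exact (uniqueDiffOn_Icc hab t ht).eq_deriv _ (hf t ht) h

/-- Proposition 2.2 (ii), first part: under Hypothesis (H), if `S(λ_k,·) ≡ 0` but the
`S(λᵢ,·)` are not all identically zero, then at least one of the two connected
components of `ℝ \ {λ₁,…,λ_m}` adjacent to `λ_k` contains no periodic solution. -/
theorem abel_adjacent_component_empty (m : ℕ) (hm : 1 ≤ m) (a : ℕ → ℝ → ℝ)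
    (ha : ∀ i ≤ m, ContDiffOn ℝ (⊤ : ℕ∞) (a i) (Set.Icc (0:ℝ) 1))
    (S : ℝ → ℝ → ℝ)
    (hS : ∀ x t, S x t = ∑ i ∈ Finset.range (m + 1), a i t * x ^ i)
    (lam : ℕ → ℝ)
    (hlt : ∀ i j, 1 ≤ i → i < j → j ≤ m → lam i < lam j)
    (hsign : (∀ i, 1 ≤ i → i ≤ m → ∀ t ∈ Set.Icc (0:ℝ) 1, 0 ≤ (-1:ℝ) ^ i * S (lam i) t) ∨
             (∀ i, 1 ≤ i → i ≤ m → ∀ t ∈ Set.Icc (0:ℝ) 1, (-1:ℝ) ^ i * S (lam i) t ≤ 0))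
    (hnotall : ¬ ∀ i, 1 ≤ i → i ≤ m → ∀ t ∈ Set.Icc (0:ℝ) 1, S (lam i) t = 0)
    (k : ℕ) (hk1 : 1 ≤ k) (hkm : k ≤ m)
    (hzero : ∀ t ∈ Set.Icc (0:ℝ) 1, S (lam k) t = 0)
    (U1 U2 : Set ℝ)
    (hU1 : (k = 1 ∧ U1 = Set.Iio (lam 1)) ∨
           (2 ≤ k ∧ U1 = Set.Ioo (lam (k - 1)) (lam k)))
    (hU2 : (k = m ∧ U2 = Set.Ioi (lam m)) ∨
           (k < m ∧ U2 = Set.Ioo (lam k) (lam (k + 1)))) :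
    (¬ ∃ x : ℝ → ℝ, IsPeriodicSol S x ∧ ∀ t ∈ Set.Icc (0:ℝ) 1, x t ∈ U1) ∨
    (¬ ∃ x : ℝ → ℝ, IsPeriodicSol S x ∧ ∀ t ∈ Set.Icc (0:ℝ) 1, x t ∈ U2) := by
  by_contra hcon
  push Not at hcon
  obtain ⟨⟨x, ⟨hx, hxper⟩, hxU⟩, y, ⟨hy, hyper⟩, hyU⟩ := hcon
  set s := Finset.Icc 1 m
  set w := Lagrange.nodalWeight s lam
  have hle : ∀ i j, 1 ≤ i → i ≤ j → j ≤ m → lam i ≤ lam j := fun i j hi hij hj ↦ by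
    rcases hij.eq_or_lt with rfl | h
    · exact le_rfl
    · exact (hlt i j hi h hj).le
  have hxk : ∀ t ∈ Icc (0 : ℝ) 1, x t < lam k := fun t ht ↦ by
    rcases hU1 with ⟨rfl, rfl⟩ | ⟨-, rfl⟩
    · exact hxU t ht
    · exact (hxU t ht).2
  have hyk : ∀ t ∈ Icc (0 : ℝ) 1, lam k < y t := fun t ht ↦ by
    rcases hU2 with ⟨rfl, rfl⟩ | ⟨-, rfl⟩
    · exact hyU t ht
    · exact (hyU t ht).1
  have hxlow : ∀ t ∈ Icc (0 : ℝ) 1, ∀ i, 1 ≤ i → i < k → lam i < x t := fun t ht i hi hik ↦ by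
    rcases hU1 with ⟨rfl, rfl⟩ | ⟨-, rfl⟩
    · omega
    · exact (hle i (k - 1) hi (by omega) (by omega)).trans_lt (hxU t ht).1
  have hyup : ∀ t ∈ Icc (0 : ℝ) 1, ∀ i, i ≤ m → k < i → y t < lam i := fun t ht i hi hik ↦ by
    rcases hU2 with ⟨rfl, rfl⟩ | ⟨-, rfl⟩
    · omega
    · exact (hyU t ht).2.trans_le (hle (k + 1) i (by omega) (by omega) hi)
  have hxne : ∀ t ∈ Icc (0 : ℝ) 1, ∀ i ∈ s, x t ≠ lam i := fun t ht i hi ↦ by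
    obtain ⟨hi1, him⟩ := Finset.mem_Icc.1 hi
    rcases lt_or_ge i k with h | h
    · exact (hxlow t ht i hi1 h).ne'
    · exact ((hxk t ht).trans_le (hle k i hk1 h him)).ne
  have hyne : ∀ t ∈ Icc (0 : ℝ) 1, ∀ i ∈ s, y t ≠ lam i := fun t ht i hi ↦ by
    obtain ⟨hi1, him⟩ := Finset.mem_Icc.1 hi
    rcases lt_or_ge k i with h | h
    · exact (hyup t ht i him h).ne
    · exact ((hle i k hi1 h hkm).trans_lt (hyk t ht)).ne'
  have hinv : ∀ t ∈ Icc (0 : ℝ) 1, ∀ i ∈ s, i ≠ k →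
      0 < (x t - lam i)⁻¹ - (y t - lam i)⁻¹ := fun t ht i hi hik ↦ by
    obtain ⟨hi1, him⟩ := Finset.mem_Icc.1 hi
    have hxy := (hxk t ht).trans (hyk t ht)
    rw [sub_pos]
    rcases lt_or_gt_of_ne hik with h | h
    · exact inv_strictAnti₀ (sub_pos.2 (hxlow t ht i hi1 h)) (by linarith)
    · exact (inv_lt_inv_of_neg (sub_neg.2 (hyup t ht i him h))
        (sub_neg.2 (hxy.trans (hyup t ht i him h)))).2 (by linarith)
  have hinj : Set.InjOn lam s := by
    refine StrictMonoOn.injOn fun i hi j hj hij ↦ ?_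
    exact hlt i j (Finset.mem_Icc.1 hi).1 hij (Finset.mem_Icc.1 hj).2
  obtain ⟨ε, hε, hεnonneg⟩ : ∃ ε : ℝ, ε ≠ 0 ∧ ∀ i ∈ s, ∀ t ∈ Icc (0 : ℝ) 1,
      0 ≤ ε * (w i * S (lam i) t) := by
    have hexp (i : ℕ) (t : ℝ) : ((-1 : ℝ) ^ (m + i) * w i) * ((-1 : ℝ) ^ i * S (lam i) t) =
        (-1) ^ m * (w i * S (lam i) t) := by
      have : ((-1 : ℝ) ^ i) * (-1) ^ i = 1 := by rw [← mul_pow]; simp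
      rw [pow_add]
      linear_combination ((-1) ^ m * (w i * S (lam i) t)) * this
    rcases hsign with h | h
    · refine ⟨(-1) ^ m, by simp, fun i hi t ht ↦ ?_⟩
      rw [← hexp]
      exact mul_nonneg (nodalWeight_Icc_alternating_pos hlt hi).le
        (h i (Finset.mem_Icc.1 hi).1 (Finset.mem_Icc.1 hi).2 t ht)
    · refine ⟨-(-1) ^ m, by simp, fun i hi t ht ↦ ?_⟩
      rw [neg_mul, ← hexp, neg_nonneg]
      exact mul_nonpos_of_nonneg_of_nonpos (nodalWeight_Icc_alternating_pos hlt hi).le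
        (h i (Finset.mem_Icc.1 hi).1 (Finset.mem_Icc.1 hi).2 t ht)
  have hlog {z : ℝ → ℝ} (hz : ∀ t ∈ Icc (0 : ℝ) 1,
      HasDerivWithinAt z (S (z t) t) (Icc (0 : ℝ) 1) t)
      (hzne : ∀ t ∈ Icc (0 : ℝ) 1, ∀ i ∈ s, z t ≠ lam i) : ∀ t ∈ Icc (0 : ℝ) 1,
      HasDerivWithinAt (fun t ↦ ∑ i ∈ s, w i * Real.log (z t - lam i))
        (a m t + ∑ i ∈ s, w i * (z t - lam i)⁻¹ * S (lam i) t) (Icc (0 : ℝ) 1) t := by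
    intro t ht
    have h := HasDerivWithinAt.fun_sum fun i (hi : i ∈ s) ↦
      (((hz t ht).sub_const (lam i)).log (sub_ne_zero.2 (hzne t ht i hi))).const_mul (w i)
    refine h.congr_deriv ?_
    simp only [hS]
    rw [← sum_nodalWeight_mul_eval hm hinj (fun j ↦ a j t) (hzne t ht), Finset.sum_mul]
    exact Finset.sum_congr rfl fun i _ ↦ by rw [div_eq_mul_inv]; ring
  have hterm : ∀ t ∈ Icc (0 : ℝ) 1, ∀ i ∈ s, 0 ≤ ε * (w i * S (lam i) t) *
      ((x t - lam i)⁻¹ - (y t - lam i)⁻¹) := fun t ht i hi ↦ by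
    rcases eq_or_ne i k with rfl | hik
    · simp [hzero t ht]
    · exact mul_nonneg (hεnonneg i hi t ht) (hinv t ht i hi hik).le
  have hderiv : ∀ t ∈ Icc (0 : ℝ) 1, HasDerivWithinAt
      (fun t ↦ ε * (∑ i ∈ s, w i * Real.log (x t - lam i) -
        ∑ i ∈ s, w i * Real.log (y t - lam i)))
      (∑ i ∈ s, ε * (w i * S (lam i) t) * ((x t - lam i)⁻¹ - (y t - lam i)⁻¹))
      (Icc (0 : ℝ) 1) t := fun t ht ↦ by
    refine (((hlog hx hxne t ht).sub (hlog hy hyne t ht)).const_mul ε).congr_deriv ?_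
    rw [add_sub_add_left_eq_sub, ← Finset.sum_sub_distrib, Finset.mul_sum]
    exact Finset.sum_congr rfl fun i _ ↦ by ring
  have hsum := eq_zero_of_hasDerivWithinAt_nonneg one_pos hderiv
    (fun t ht ↦ Finset.sum_nonneg (hterm t ht)) (by simp only [hxper, hyper])
  refine hnotall fun i hi1 him t ht ↦ ?_
  rcases eq_or_ne i k with rfl | hik
  · exact hzero t ht
  have hi : i ∈ s := Finset.mem_Icc.2 ⟨hi1, him⟩
  have hwi : w i ≠ 0 := right_ne_zero_of_mul (nodalWeight_Icc_alternating_pos hlt hi).ne'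
  have h0 := (Finset.sum_eq_zero_iff_of_nonneg (hterm t ht)).1 (hsum t ht) i hi
  simpa [hε, hwi, (hinv t ht i hi hik).ne'] using h0
end

section
/- Assume equation (1) satisfies Hypothesis (H), the functions S(\lambda_1,\cdot), \ldots, S(\lambda_m,\cdot) are not all identically zero, and \lambda \in \{\lambda_1,\ldots,\lambda_m\} satisfies S(\lambda,t) = 0 for all t \in [0,1]. Then the constant periodic solution x(t) \equiv \lambda has multiplicity at most 2; concretely, it is not the case that both \int_0^1 (\partial S/\partial x)(\lambda,t)\,dt = 0 and \int_0^1 (\partial^2 S/\partial x^2)(\lambda,t) \cdot \exp\big(\int_0^t (\partial S/\partial x)(\lambda,s)\,ds\big)\,dt = 0. -/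
open Set

open Polynomial in
/-- For a polynomial `p` of degree at most the number of nodes which vanishes at the node `v k`,
the second derivative at `v k` in terms of the first one and of the values at the other nodes. -/
theorem Lagrange.eval_derivative_derivative_of_eval_eq_zero {ι F : Type*} [DecidableEq ι] [Field F]
    {s : Finset ι} {v : ι → F} (hv : Set.InjOn v s) {k : ι} (hk : k ∈ s) {p : F[X]}
    (hp : p.natDegree ≤ s.card) (hpk : p.eval (v k) = 0) :
    p.derivative.derivative.eval (v k) =
      2 * (p.derivative.eval (v k) * (Lagrange.basis s v k).derivative.eval (v k) +
        ∑ i ∈ s.erase k, p.eval (v i) *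
          ((∏ j ∈ (s.erase i).erase k, (v k - v j) / (v i - v j)) / (v i - v k) ^ 2)) := by
  obtain ⟨r, rfl⟩ := dvd_iff_isRoot.2 hpk
  have hs : 0 < s.card := Finset.card_pos.2 ⟨k, hk⟩
  have hr : r.degree < s.card := by
    rcases eq_or_ne r 0 with rfl | h0
    · simp
    · rw [natDegree_mul (X_sub_C_ne_zero _) h0, natDegree_X_sub_C] at hp
      rw [degree_eq_natDegree h0]
      exact_mod_cast (by omega : r.natDegree < s.card)
  have hb : ∀ i ∈ s.erase k, (Lagrange.basis s v i).derivative.eval (v k) =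
      (∏ j ∈ (s.erase i).erase k, (v k - v j) / (v i - v j)) / (v i - v k) := by
    intro i hi
    have hik : i ≠ k := Finset.ne_of_mem_erase hi
    have hk' : k ∈ s.erase i := Finset.mem_erase.2 ⟨hik.symm, hk⟩
    rw [Lagrange.basis, ← Finset.mul_prod_erase _ _ hk', derivative_mul]
    simp [Lagrange.basisDivisor, eval_prod, div_eq_mul_inv, mul_comm]
  have hrr : r.derivative.eval (v k) =
      ∑ i ∈ s, r.eval (v i) * (Lagrange.basis s v i).derivative.eval (v k) := by
    conv_lhs => rw [Lagrange.eq_interpolate hv hr]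
    simp [Lagrange.interpolate_apply, eval_finsetSum]
  have h1 : (derivative ((X - C (v k)) * r)).eval (v k) = r.eval (v k) := by simp
  have h2 : (derivative (derivative ((X - C (v k)) * r))).eval (v k) =
      2 * r.derivative.eval (v k) := by
    simp [derivative_mul]; ring
  rw [h1, h2, hrr, ← Finset.add_sum_erase _ _ hk]
  congr 2
  refine Finset.sum_congr rfl fun i hi => ?_
  have hne : v i - v k ≠ 0 := sub_ne_zero.2 fun h =>
    Finset.ne_of_mem_erase hi (hv (Finset.mem_of_mem_erase hi) hk h)
  rw [hb i hi]
  simp only [eval_mul, eval_sub, eval_X, eval_C]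
  field_simp

theorem Finset.neg_one_pow_card_mul_prod_pos {ι : Type*} [DecidableEq ι] {s u : Finset ι}
    (hus : u ⊆ s) {f : ι → ℝ} (hneg : ∀ j ∈ u, f j < 0) (hpos : ∀ j ∈ s \ u, 0 < f j) :
    0 < (-1 : ℝ) ^ u.card * ∏ j ∈ s, f j := by
  rw [← Finset.prod_sdiff hus, mul_left_comm, ← Finset.prod_const, ← Finset.prod_mul_distrib]
  exact mul_pos (Finset.prod_pos hpos) (Finset.prod_pos fun j hj => by linarith [hneg j hj])

/-- For ordered nodes, the sign of the product of `(v k - v j) / (v i - v j)` over `j ≠ i, k`. -/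
theorem neg_one_pow_mul_prod_sub_div_sub_pos {m : ℕ} {v : ℕ → ℝ}
    (hv : StrictMonoOn v (Set.Icc 1 m)) {i k : ℕ} (hi : i ∈ Finset.Icc 1 m)
    (hk : k ∈ Finset.Icc 1 m) (hik : i ≠ k) :
    0 < (-1 : ℝ) ^ (i + k + 1) *
      ∏ j ∈ ((Finset.Icc 1 m).erase i).erase k, (v k - v j) / (v i - v j) := by
  rw [Finset.mem_Icc] at hi hk
  have key : ∀ a b : ℕ, 1 ≤ a → a < b → b ≤ m → (a = i ∧ b = k ∨ a = k ∧ b = i) →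
      0 < (-1 : ℝ) ^ (i + k + 1) *
        ∏ j ∈ ((Finset.Icc 1 m).erase i).erase k, (v k - v j) / (v i - v j) := by
    intro a b ha hab hb h
    have hpow : (-1 : ℝ) ^ (i + k + 1) = (-1) ^ (Finset.Ioo a b).card := by
      rw [Nat.card_Ioo, show i + k + 1 = (b - a - 1) + 2 * (a + 1) by omega, pow_add, pow_mul]
      simp
    have hlt : ∀ x y, 1 ≤ x → x < y → y ≤ m → v x < v y := fun x y hx hxy hy =>
      hv ⟨hx, by omega⟩ ⟨by omega, hy⟩ hxy
    rw [hpow]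
    refine Finset.neg_one_pow_card_mul_prod_pos ?_ ?_ ?_
    · intro j hj
      simp only [Finset.mem_Ioo, Finset.mem_erase, Finset.mem_Icc] at hj ⊢
      omega
    · intro j hj
      rw [Finset.mem_Ioo] at hj
      have h1 := hlt a j ha hj.1 (by omega)
      have h2 := hlt j b (by omega) hj.2 hb
      rcases h with ⟨rfl, rfl⟩ | ⟨rfl, rfl⟩
      · exact div_neg_of_pos_of_neg (by linarith) (by linarith)
      · exact div_neg_of_neg_of_pos (by linarith) (by linarith)
    · intro j hj
      simp only [Finset.mem_sdiff, Finset.mem_Ioo, Finset.mem_erase, Finset.mem_Icc] at hj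
      have hab' := hlt a b ha hab hb
      rcases (by omega : j < a ∨ b < j) with hja | hbj
      · have h1 := hlt j a (by omega) hja (by omega)
        rcases h with ⟨rfl, rfl⟩ | ⟨rfl, rfl⟩ <;> exact div_pos (by linarith) (by linarith)
      · have h1 := hlt b j (by omega) hbj (by omega)
        rcases h with ⟨rfl, rfl⟩ | ⟨rfl, rfl⟩ <;>
          exact div_pos_of_neg_of_neg (by linarith) (by linarith)
  rcases lt_or_gt_of_ne hik with h | h
  · exact key i k hi.1 h hk.2 (Or.inl ⟨rfl, rfl⟩)
  · exact key k i hk.1 h hi.2 (Or.inr ⟨rfl, rfl⟩)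

theorem continuousOn_exp_integral_Icc {D : ℝ → ℝ} {a b : ℝ} (hab : a ≤ b)
    (hD : ContinuousOn D (Set.Icc a b)) :
    ContinuousOn (fun t => Real.exp (∫ s in a..t, D s)) (Set.Icc a b) := by
  have h := intervalIntegral.continuousOn_primitive_interval (μ := MeasureTheory.volume)
    (f := D) (a := a) (b := b)
    (by rw [Set.uIcc_of_le hab]; exact hD.integrableOn_Icc)
  rw [Set.uIcc_of_le hab] at h
  exact Real.continuous_exp.comp_continuousOn h

theorem integral_mul_exp_integral {D : ℝ → ℝ} {a b : ℝ} (hab : a ≤ b)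
    (hD : ContinuousOn D (Set.Icc a b)) :
    ∫ t in a..b, D t * Real.exp (∫ s in a..t, D s) = Real.exp (∫ s in a..b, D s) - 1 := by
  have hE := continuousOn_exp_integral_Icc hab hD
  have hint : IntervalIntegrable (fun t => D t * Real.exp (∫ s in a..t, D s))
      MeasureTheory.volume a b := (hD.mul hE).intervalIntegrable_of_Icc hab
  rw [intervalIntegral.integral_eq_sub_of_hasDerivAt_of_le hab hE _ hint]
  · simp
  · intro t ht
    have hnhds : Set.Icc a b ∈ nhds t := Icc_mem_nhds ht.1 ht.2
    have hd : HasDerivAt (fun u => ∫ s in a..u, D s) (D t) t :=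
      intervalIntegral.integral_hasDerivAt_right
        ((hD.mono (Set.Icc_subset_Icc_right ht.2.le)).intervalIntegrable_of_Icc ht.1.le)
        ((hD.mono Set.Ioo_subset_Icc_self).stronglyMeasurableAtFilter isOpen_Ioo t ht)
        (hD.continuousAt hnhds)
    rw [mul_comm]
    exact hd.exp

/-- Proposition 2.2 (ii), second part: under Hypothesis (H), if `S(λ_k,·) ≡ 0` but the
`S(λᵢ,·)` are not all identically zero, then the constant periodic solution `x ≡ λ_k`
has multiplicity at most `2`: it is not the case that both
`∫₀¹ ∂S/∂x(λ_k,t) dt = 0` and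
`∫₀¹ ∂²S/∂x²(λ_k,t) · exp(∫₀ᵗ ∂S/∂x(λ_k,s) ds) dt = 0`. -/
theorem abel_constant_multiplicity_le_two (m : ℕ) (hm : 1 ≤ m) (a : ℕ → ℝ → ℝ)
    (ha : ∀ i ≤ m, ContDiffOn ℝ (⊤ : ℕ∞) (a i) (Set.Icc (0:ℝ) 1))
    (S : ℝ → ℝ → ℝ)
    (hS : ∀ x t, S x t = ∑ i ∈ Finset.range (m + 1), a i t * x ^ i)
    (lam : ℕ → ℝ)
    (hlt : ∀ i j, 1 ≤ i → i < j → j ≤ m → lam i < lam j)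
    (hsign : (∀ i, 1 ≤ i → i ≤ m → ∀ t ∈ Set.Icc (0:ℝ) 1, 0 ≤ (-1:ℝ) ^ i * S (lam i) t) ∨
             (∀ i, 1 ≤ i → i ≤ m → ∀ t ∈ Set.Icc (0:ℝ) 1, (-1:ℝ) ^ i * S (lam i) t ≤ 0))
    (hnotall : ¬ ∀ i, 1 ≤ i → i ≤ m → ∀ t ∈ Set.Icc (0:ℝ) 1, S (lam i) t = 0)
    (k : ℕ) (hk1 : 1 ≤ k) (hkm : k ≤ m)
    (hzero : ∀ t ∈ Set.Icc (0:ℝ) 1, S (lam k) t = 0) :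
    ¬ ((∫ t in (0:ℝ)..1, deriv (fun y => S y t) (lam k)) = 0 ∧
       (∫ t in (0:ℝ)..1, deriv (deriv (fun y => S y t)) (lam k) *
          Real.exp (∫ s in (0:ℝ)..t, deriv (fun y => S y s) (lam k))) = 0) := by
  rintro ⟨hI1, hI2⟩
  have hmono : StrictMonoOn lam (Set.Icc 1 m) := fun i hi j hj hij => hlt i j hi.1 hij hj.2
  have hkmem : k ∈ Finset.Icc 1 m := Finset.mem_Icc.2 ⟨hk1, hkm⟩
  let p : ℝ → Polynomial ℝ := fun t =>
    ∑ i ∈ Finset.range (m + 1), Polynomial.C (a i t) * Polynomial.X ^ i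
  have hpS : ∀ t, (fun y => S y t) = fun y => (p t).eval y := fun t => by
    ext y
    simp [p, hS, Polynomial.eval_finsetSum]
  have hpdeg : ∀ t, (p t).natDegree ≤ (Finset.Icc 1 m).card := fun t => by
    rw [Nat.card_Icc, Nat.add_sub_cancel]
    exact Polynomial.natDegree_sum_le_of_forall_le _ _ fun i hi =>
      (Polynomial.natDegree_C_mul_X_pow_le _ _).trans (Finset.mem_range_succ_iff.1 hi)
  have hd1 : ∀ t, deriv (fun y => S y t) = fun y => (p t).derivative.eval y := fun t => by
    rw [hpS]
    ext y
    exact (p t).deriv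
  have hd2 : ∀ t, deriv (deriv (fun y => S y t)) =
      fun y => (p t).derivative.derivative.eval y := fun t => by
    rw [hd1]
    ext y
    exact (p t).derivative.deriv
  set D : ℝ → ℝ := fun t => deriv (fun y => S y t) (lam k) with hDdef
  have ha' : ∀ i ∈ Finset.range (m + 1), ContinuousOn (a i) (Set.Icc 0 1) := fun i hi =>
    (ha i (Finset.mem_range_succ_iff.1 hi)).continuousOn
  have hDc : ContinuousOn D (Set.Icc 0 1) := by
    have hD' : D = fun t => ∑ i ∈ Finset.range (m + 1), a i t * (i * lam k ^ (i - 1)) := by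
      ext t
      simp [hDdef, hd1, p, Polynomial.derivative_X_pow, Polynomial.eval_finsetSum]
    rw [hD']
    exact continuousOn_finsetSum _ fun i hi => (ha' i hi).mul continuousOn_const
  have hSc : ∀ x, ContinuousOn (fun t => S x t) (Set.Icc 0 1) := fun x => by
    simp only [hS]
    exact continuousOn_finsetSum _ fun i hi => (ha' i hi).mul continuousOn_const
  obtain ⟨e, he, hesign⟩ : ∃ e : ℝ, e ≠ 0 ∧ ∀ i, 1 ≤ i → i ≤ m → ∀ t ∈ Set.Icc (0 : ℝ) 1,
      0 ≤ e * ((-1 : ℝ) ^ i * S (lam i) t) := by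
    rcases hsign with h | h
    · exact ⟨1, one_ne_zero, fun i h1 h2 t ht => by linarith [h i h1 h2 t ht]⟩
    · exact ⟨-1, by norm_num, fun i h1 h2 t ht => by linarith [h i h1 h2 t ht]⟩
  let w : ℕ → ℝ := fun i =>
    (∏ j ∈ ((Finset.Icc 1 m).erase i).erase k, (lam k - lam j) / (lam i - lam j)) /
      (lam i - lam k) ^ 2
  have hw : ∀ i ∈ (Finset.Icc 1 m).erase k, 0 < (-1 : ℝ) ^ (i + k + 1) * w i := by
    intro i hi
    obtain ⟨hik, him⟩ := Finset.mem_erase.1 hi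
    have hne : lam i - lam k ≠ 0 := sub_ne_zero.2 fun h =>
      hik (hmono.injOn (Finset.mem_Icc.1 him) (Finset.mem_Icc.1 hkmem) h)
    rw [← mul_div_assoc]
    exact div_pos (neg_one_pow_mul_prod_sub_div_sub_pos hmono him hkmem hik) (by positivity)
  let F : ℝ → ℝ := fun t => ∑ i ∈ (Finset.Icc 1 m).erase k,
    e * ((-1 : ℝ) ^ i * S (lam i) t) * ((-1 : ℝ) ^ (i + k + 1) * w i)
  have hterm : ∀ t ∈ Set.Icc (0 : ℝ) 1, ∀ i ∈ (Finset.Icc 1 m).erase k,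
      0 ≤ e * ((-1 : ℝ) ^ i * S (lam i) t) * ((-1 : ℝ) ^ (i + k + 1) * w i) := fun t ht i hi =>
    mul_nonneg (hesign i (Finset.mem_Icc.1 (Finset.mem_of_mem_erase hi)).1
      (Finset.mem_Icc.1 (Finset.mem_of_mem_erase hi)).2 t ht) (hw i hi).le
  have hF0 : ∀ t ∈ Set.Icc (0 : ℝ) 1, 0 ≤ F t := fun t ht => Finset.sum_nonneg (hterm t ht)
  have hFc : ContinuousOn F (Set.Icc 0 1) :=
    continuousOn_finsetSum _ fun i _ =>
      (continuousOn_const.mul (continuousOn_const.mul (hSc _))).mul continuousOn_const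
  have hsq : ∀ i : ℕ, (-1 : ℝ) ^ i * (-1) ^ i = 1 := fun i => by
    rw [← mul_pow]; simp
  set c : ℝ := (Lagrange.basis (Finset.Icc 1 m) lam k).derivative.eval (lam k)
  have hF : ∀ t ∈ Set.Icc (0 : ℝ) 1,
      F t = e * (-1) ^ (k + 1) * (deriv (deriv (fun y => S y t)) (lam k) / 2 - c * D t) := by
    intro t ht
    have hev : ∀ x, (p t).eval x = S x t := fun x => (congrFun (hpS t) x).symm
    have h := Lagrange.eval_derivative_derivative_of_eval_eq_zero (s := Finset.Icc 1 m)
      (v := lam) (by rw [Finset.coe_Icc]; exact hmono.injOn) hkmem (hpdeg t)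
      (by rw [hev]; exact hzero t ht)
    have hDt : D t = (p t).derivative.eval (lam k) := by rw [hDdef]; simp only [hd1]
    have hFw : F t = e * (-1) ^ (k + 1) *
        ∑ i ∈ (Finset.Icc 1 m).erase k, (p t).eval (lam i) * w i := by
      rw [Finset.mul_sum]
      refine Finset.sum_congr rfl fun i _ => ?_
      rw [hev, add_assoc, pow_add]
      linear_combination (e * S (lam i) t * (-1) ^ (k + 1) * w i) * hsq i
    rw [hFw, hDt, hd2]
    simp only [h]
    ring
  have hEc := continuousOn_exp_integral_Icc zero_le_one hDc
  have hIF : ∫ t in (0 : ℝ)..1, F t * Real.exp (∫ s in (0 : ℝ)..t, D s) = 0 := by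
    have hDE := integral_mul_exp_integral zero_le_one hDc
    rw [show ∫ s in (0 : ℝ)..1, D s = 0 from hI1, Real.exp_zero, sub_self] at hDE
    have hiF : IntervalIntegrable (fun t => F t * Real.exp (∫ s in (0 : ℝ)..t, D s))
        MeasureTheory.volume 0 1 := (hFc.mul hEc).intervalIntegrable_of_Icc zero_le_one
    have hiD : IntervalIntegrable (fun t => D t * Real.exp (∫ s in (0 : ℝ)..t, D s))
        MeasureTheory.volume 0 1 := (hDc.mul hEc).intervalIntegrable_of_Icc zero_le_one
    have hconst : e * (-1) ^ (k + 1) ≠ 0 := mul_ne_zero he (pow_ne_zero _ (by norm_num))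
    have hcongr : ∫ t in (0 : ℝ)..1, deriv (deriv (fun y => S y t)) (lam k) *
          Real.exp (∫ s in (0 : ℝ)..t, D s) =
        ∫ t in (0 : ℝ)..1, (2 / (e * (-1) ^ (k + 1))) *
          (F t * Real.exp (∫ s in (0 : ℝ)..t, D s)) +
          2 * c * (D t * Real.exp (∫ s in (0 : ℝ)..t, D s)) := by
      refine intervalIntegral.integral_congr fun t ht => ?_
      rw [Set.uIcc_of_le zero_le_one] at ht
      simp only [hF t ht]
      field_simp
      ring
    rw [hcongr, intervalIntegral.integral_add (hiF.const_mul _) (hiD.const_mul _),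
      intervalIntegral.integral_const_mul, intervalIntegral.integral_const_mul, hDE, mul_zero,
      add_zero] at hI2
    exact (mul_eq_zero.1 hI2).resolve_left (div_ne_zero two_ne_zero hconst)
  have hFzero : ∀ t ∈ Set.Icc (0 : ℝ) 1, F t = 0 := by
    by_contra! ⟨t, ht, hne⟩
    refine (intervalIntegral.integral_pos zero_lt_one (hFc.mul hEc)
      (fun x hx => mul_nonneg (hF0 x (Set.Ioc_subset_Icc_self hx)) (Real.exp_pos _).le)
      ⟨t, ht, mul_pos ((hF0 t ht).lt_of_ne' hne) (Real.exp_pos _)⟩).ne' hIF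
  refine hnotall fun i hi1 him t ht => ?_
  rcases eq_or_ne i k with rfl | hik
  · exact hzero t ht
  · have hi : i ∈ (Finset.Icc 1 m).erase k :=
      Finset.mem_erase.2 ⟨hik, Finset.mem_Icc.2 ⟨hi1, him⟩⟩
    have h0 := (Finset.sum_eq_zero_iff_of_nonneg (hterm t ht)).1 (hFzero t ht) i hi
    simpa [he, (hw i hi).ne'] using (mul_eq_zero.1 h0).resolve_right (hw i hi).ne'
end

section
/- Let L \in C^1(\mathbb{R}) and p \in C^1([0,1]). If x : [0,T] \to \mathbb{R} (0 < T \le 1) is a solution of dx/dt = p(t) L(x), then for every t \in [0,T]: sgn(x(t) - x(0)) = sgn(\int_0^t p(s)\,ds) \cdot sgn(L(x(0))), where sgn denotes the sign function taking values in \{-1, 0, 1\}. -/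
open Set

/-- A solution of the separable equation `dx/dt = p(t) L(x)` that meets a zero of `L` is constant. -/
theorem separable_eqOn_const {L p x : ℝ → ℝ} {a b t₀ : ℝ} (hL : ContDiff ℝ 1 L)
    (hp : ContinuousOn p (Icc a b))
    (hx : ∀ t ∈ Icc a b, HasDerivWithinAt x (p t * L (x t)) (Icc a b) t)
    (ht₀ : t₀ ∈ Icc a b) (h₀ : L (x t₀) = 0) :
    EqOn x (fun _ ↦ x t₀) (Icc a b) := by
  have hxc : ContinuousOn x (Icc a b) := fun t ht ↦ (hx t ht).continuousWithinAt
  obtain ⟨K, hK⟩ := hL.locallyLipschitz.locallyLipschitzOn.exists_lipschitzOnWith_of_compact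
    (isCompact_Icc.image_of_continuousOn hxc)
  obtain ⟨C, hC⟩ := isCompact_Icc.exists_bound_of_continuousOn hp
  have hv : ∀ t ∈ Icc a b,
      LipschitzOnWith (C.toNNReal * K) (fun y ↦ p t * L y) (x '' Icc a b) := by
    intro t ht
    refine LipschitzOnWith.of_dist_le_mul fun y hy z hz ↦ ?_
    have hyz := hK.dist_le_mul y hy z hz
    rw [Real.dist_eq, ← mul_sub, abs_mul, NNReal.coe_mul, mul_assoc]
    exact mul_le_mul ((hC t ht).trans (Real.le_coe_toNNReal C)) hyz (abs_nonneg _) (by positivity)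
  have hmem : x t₀ ∈ x '' Icc a b := mem_image_of_mem x ht₀
  have hleft : EqOn x (fun _ ↦ x t₀) (Icc a t₀) := by
    have hsub : Ioc a t₀ ⊆ Icc a b := fun t ht ↦ ⟨ht.1.le, ht.2.trans ht₀.2⟩
    refine ODE_solution_unique_of_mem_Icc_left (v := fun t y ↦ p t * L y)
      (s := fun _ ↦ x '' Icc a b) (fun t ht ↦ hv t (hsub ht))
      (hxc.mono (Icc_subset_Icc_right ht₀.2)) (fun t ht ↦ ?_)
      (fun t ht ↦ mem_image_of_mem x (hsub ht)) continuousOn_const (fun t ht ↦ ?_)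
      (fun _ _ ↦ hmem) rfl
    · exact (hx t (hsub ht)).mono_of_mem_nhdsWithin
        (Filter.mem_of_superset (Icc_mem_nhdsLE ht.1) (Icc_subset_Icc_right (hsub ht).2))
    · simpa [h₀] using hasDerivWithinAt_const t (Iic t) (x t₀)
  have hright : EqOn x (fun _ ↦ x t₀) (Icc t₀ b) := by
    have hsub : Ico t₀ b ⊆ Icc a b := fun t ht ↦ ⟨ht₀.1.trans ht.1, ht.2.le⟩
    refine ODE_solution_unique_of_mem_Icc_right (v := fun t y ↦ p t * L y)
      (s := fun _ ↦ x '' Icc a b) (fun t ht ↦ hv t (hsub ht))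
      (hxc.mono (Icc_subset_Icc_left ht₀.1)) (fun t ht ↦ ?_)
      (fun t ht ↦ mem_image_of_mem x (hsub ht)) continuousOn_const (fun t ht ↦ ?_)
      (fun _ _ ↦ hmem) rfl
    · exact (hx t (hsub ht)).mono_of_mem_nhdsWithin
        (Filter.mem_of_superset (Icc_mem_nhdsGE ht.2) (Icc_subset_Icc_left (hsub ht).1))
    · simpa [h₀] using hasDerivWithinAt_const t (Ici t) (x t₀)
  intro t ht
  rcases le_total t t₀ with h | h
  · exact hleft ⟨ht.1, h⟩
  · exact hright ⟨h, ht.2⟩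

theorem Real.sign_mul (a b : ℝ) : Real.sign (a * b) = Real.sign a * Real.sign b := by
  rcases lt_trichotomy a 0 with ha | rfl | ha <;> rcases lt_trichotomy b 0 with hb | rfl | hb <;>
    simp [Real.sign_of_neg, Real.sign_of_pos, mul_pos_of_neg_of_neg, mul_neg_of_neg_of_pos,
      mul_neg_of_pos_of_neg, *]

theorem StrictMono.sign_sub_eq {f : ℝ → ℝ} (hf : StrictMono f) (y z : ℝ) :
    Real.sign (f y - f z) = Real.sign (y - z) := by
  rcases lt_trichotomy y z with h | rfl | h
  · rw [Real.sign_of_neg (sub_neg.2 h), Real.sign_of_neg (sub_neg.2 (hf h))]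
  · simp
  · rw [Real.sign_of_pos (sub_pos.2 h), Real.sign_of_pos (sub_pos.2 (hf h))]

/-- If `L` has no zero on `[a, b]`, then some strictly increasing function has derivative
`L c / L y` at every `y ∈ [a, b]`. -/
theorem exists_strictMono_hasDerivAt_div {L : ℝ → ℝ} {a b c : ℝ} (hL : Continuous L)
    (hne : ∀ y ∈ Icc a b, L y ≠ 0) (hc : c ∈ Icc a b) :
    ∃ H : ℝ → ℝ, StrictMono H ∧ ∀ y ∈ Icc a b, HasDerivAt H (L c / L y) y := by
  have hab : a ≤ b := hc.1.trans hc.2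
  have hpos : ∀ y ∈ Icc a b, 0 < L c / L y := by
    intro y hy
    by_contra! hle
    obtain ⟨z, hz, hz0⟩ : (0 : ℝ) ∈ (fun y ↦ L c / L y) '' Icc a b :=
      isPreconnected_Icc.intermediate_value hy hc
        (continuousOn_const.div hL.continuousOn hne) ⟨hle, by simp [hne c hc]⟩
    exact div_ne_zero (hne c hc) (hne z hz) hz0
  set g : ℝ → ℝ := fun y ↦ L c / L (projIcc a b hab y)
  have hg : Continuous g := by
    refine continuous_const.div (hL.comp (continuous_subtype_val.comp continuous_projIcc))
      fun y ↦ hne _ (projIcc a b hab y).2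
  have hH (y : ℝ) : HasDerivAt (fun y ↦ ∫ s in c..y, g s) (g y) y :=
    hg.integral_hasStrictDerivAt c y |>.hasDerivAt
  refine ⟨fun y ↦ ∫ s in c..y, g s, strictMono_of_deriv_pos fun y ↦ ?_, fun y hy ↦ ?_⟩
  · rw [(hH y).deriv]
    exact hpos _ (projIcc a b hab y).2
  · simpa [g, projIcc_of_mem hab hy] using hH y

/-- Lemma 2.3 (i): along a solution of the separable equation `dx/dt = p(t)·L(x)`,
`sgn(x(t) - x(0)) = sgn(∫₀ᵗ p) · sgn(L(x(0)))`. -/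
theorem separable_sign_identity (L : ℝ → ℝ) (hL : ContDiff ℝ 1 L)
    (p : ℝ → ℝ) (hp : ContDiffOn ℝ 1 p (Set.Icc (0:ℝ) 1))
    (T : ℝ) (hT0 : 0 < T) (hT1 : T ≤ 1)
    (x : ℝ → ℝ)
    (hx : ∀ t ∈ Set.Icc (0:ℝ) T, HasDerivWithinAt x (p t * L (x t)) (Set.Icc (0:ℝ) T) t) :
    ∀ t ∈ Set.Icc (0:ℝ) T,
      Real.sign (x t - x 0) = Real.sign (∫ s in (0:ℝ)..t, p s) * Real.sign (L (x 0)) := by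
  intro t ht
  have hpc : ContinuousOn p (Icc 0 T) := hp.continuousOn.mono (Icc_subset_Icc_right hT1)
  have hxc : ContinuousOn x (Icc 0 T) := fun s hs ↦ (hx s hs).continuousWithinAt
  have h0 : (0 : ℝ) ∈ Icc 0 T := left_mem_Icc.2 hT0.le
  by_cases hL0 : L (x 0) = 0
  · simp [separable_eqOn_const hL hpc hx h0 hL0 ht, hL0]
  have himg := hxc.image_Icc hT0.le
  have hmem : ∀ s ∈ Icc 0 T, x s ∈ Icc (sInf (x '' Icc 0 T)) (sSup (x '' Icc 0 T)) :=
    fun s hs ↦ himg ▸ mem_image_of_mem x hs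
  have hne : ∀ y ∈ Icc (sInf (x '' Icc 0 T)) (sSup (x '' Icc 0 T)), L y ≠ 0 := by
    rw [← himg]
    rintro _ ⟨s, hs, rfl⟩ hs0
    have heq : x 0 = x s := separable_eqOn_const hL hpc hx hs hs0 h0
    exact hL0 (heq ▸ hs0)
  obtain ⟨H, hmono, hH⟩ := exists_strictMono_hasDerivAt_div hL.continuous hne (hmem 0 h0)
  have hHx : ∀ s ∈ Icc 0 T, HasDerivWithinAt (H ∘ x) (p s * L (x 0)) (Icc 0 T) s := by
    intro s hs
    have hLs := hne _ (hmem s hs)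
    refine ((hH _ (hmem s hs)).comp_hasDerivWithinAt s (hx s hs)).congr_deriv ?_
    field_simp
  have hsub : Icc 0 t ⊆ Icc 0 T := Icc_subset_Icc_right ht.2
  have hint : ∫ s in (0 : ℝ)..t, p s * L (x 0) = H (x t) - H (x 0) := by
    refine intervalIntegral.integral_eq_sub_of_hasDerivAt_of_le (f := H ∘ x) ht.1
      (fun s hs ↦ ((hHx s (hsub hs)).continuousWithinAt.mono hsub)) (fun s hs ↦ ?_) ?_
    · exact (hHx s (hsub (Ioo_subset_Icc_self hs))).hasDerivAt
        (Icc_mem_nhds hs.1 (hs.2.trans_le ht.2))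
    · refine ContinuousOn.intervalIntegrable ?_
      rw [uIcc_of_le ht.1]
      exact (hpc.mono hsub).mul continuousOn_const
  rw [← hmono.sign_sub_eq, ← hint, intervalIntegral.integral_mul_const, Real.sign_mul]
end

section
/- Let L \in C^1(\mathbb{R}), p \in C^1([0,1]), a < b with L(a) = 0 or L(b) = 0, let E \subseteq [0,1] be a nonempty open set, and let q \in C^1(\mathbb{R} \times [0,1]) satisfy q(x,t) \ge 0 for all (x,t) \in (a,b) \times [0,1] (resp. q \le 0) and q(x,t) \ne 0 for all (x,t) \in (a,b) \times E. Assume sgn(\int_0^1 p(s)\,ds) \cdot sgn(L(x)) \cdot sgn(q(x,t)) \ge 0 for all (x,t) \in (a,b) \times E. Then the equation dx/dt = p(t)L(x) + q(x,t) has no periodic solution taking values in (a,b); moreover every solution \tilde{x} defined on [0,1] with \tilde{x}(t) \in (a,b) for all t \in [0,1] satisfies sgn(\tilde{x}(1) - \tilde{x}(0)) = sgn(q(x,t)) for every (x,t) \in (a,b) \times E. -/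
open Set

/-- A function on `[0,1]` with nonnegative derivative, positive at some point, has
`f 0 < f 1` and is monotone. -/
theorem monotoneOn_and_lt_of_hasDerivWithinAt {f f' : ℝ → ℝ}
    (hf : ∀ t ∈ Icc (0:ℝ) 1, HasDerivWithinAt f (f' t) (Icc (0:ℝ) 1) t)
    (hf' : ∀ t ∈ Icc (0:ℝ) 1, 0 ≤ f' t) {t₀ : ℝ} (ht₀ : t₀ ∈ Icc (0:ℝ) 1) (hpos : 0 < f' t₀) :
    MonotoneOn f (Icc (0:ℝ) 1) ∧ f 0 < f 1 := by
  have hmono : MonotoneOn f (Icc (0:ℝ) 1) := by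
    refine monotoneOn_of_hasDerivWithinAt_nonneg (f' := f') (convex_Icc 0 1)
      (fun t ht => (hf t ht).continuousWithinAt) (fun t ht => ?_) (fun t ht => ?_)
    · exact (hf t (interior_subset ht)).mono interior_subset
    · exact hf' t (interior_subset ht)
  refine ⟨hmono, ?_⟩
  by_contra! hle
  have h0 : (0:ℝ) ∈ Icc (0:ℝ) 1 := by simp
  have h1 : (1:ℝ) ∈ Icc (0:ℝ) 1 := by simp
  have hconst : ∀ t ∈ Icc (0:ℝ) 1, f t = f 0 := fun t ht =>
    le_antisymm ((hmono ht h1 ht.2).trans hle) (hmono h0 ht ht.1)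
  have hzero : HasDerivWithinAt f 0 (Icc (0:ℝ) 1) t₀ :=
    (hasDerivWithinAt_const t₀ _ (f 0)).congr hconst (hconst t₀ ht₀)
  have := (uniqueDiffOn_Icc (zero_lt_one' ℝ) t₀ ht₀).eq_deriv _ (hf t₀ ht₀) hzero
  exact hpos.ne' this

/-- A continuous function on `[0,1]` has its integral as an antiderivative there. -/
theorem exists_antideriv_of_continuousOn_unitInterval {g : ℝ → ℝ}
    (hg : ContinuousOn g (Icc (0:ℝ) 1)) :
    ∃ A : ℝ → ℝ, A 0 = 0 ∧ A 1 = ∫ s in (0:ℝ)..1, g s ∧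
      ∀ t ∈ Icc (0:ℝ) 1, HasDerivWithinAt A (g t) (Icc (0:ℝ) 1) t := by
  set G : ℝ → ℝ := IccExtend (zero_le_one' ℝ) ((Icc (0:ℝ) 1).domRestrict g)
  have hGc : Continuous G := hg.domRestrict.Icc_extend'
  have hGg : ∀ t ∈ Icc (0:ℝ) 1, G t = g t := fun t ht => by
    simp [G, IccExtend_of_mem _ _ ht, domRestrict]
  refine ⟨fun t => ∫ s in (0:ℝ)..t, G s, by simp, ?_, fun t ht => ?_⟩
  · refine intervalIntegral.integral_congr fun t ht => hGg t ?_
    rwa [uIcc_of_le (zero_le_one' ℝ)] at ht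
  · rw [← hGg t ht]
    exact (hGc.integral_hasStrictDerivAt 0 t).hasDerivAt.hasDerivWithinAt

section

variable {L p r x : ℝ → ℝ}

/-- If a solution meets a zero of `L`, then a nonnegative forcing makes it increase. -/
theorem lt_of_forcing_nonneg_of_meets_zero (hL : ContDiff ℝ 1 L)
    (hp : ContinuousOn p (Icc (0:ℝ) 1))
    (hx : ∀ t ∈ Icc (0:ℝ) 1, HasDerivWithinAt x (p t * L (x t) + r t) (Icc (0:ℝ) 1) t)
    (hr : ∀ t ∈ Icc (0:ℝ) 1, 0 ≤ r t) {t₀ : ℝ} (ht₀ : t₀ ∈ Icc (0:ℝ) 1) (hpos : 0 < r t₀)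
    {s : ℝ} (hs : s ∈ Icc (0:ℝ) 1) (hLs : L (x s) = 0) : x 0 < x 1 := by
  have hxc : ContinuousOn x (Icc (0:ℝ) 1) := fun t ht => (hx t ht).continuousWithinAt
  have hslope : Continuous (dslope L (x s)) := by
    rw [← continuousOn_univ, continuousOn_dslope Filter.univ_mem]
    exact ⟨hL.continuous.continuousOn, hL.differentiable one_ne_zero _⟩
  have hfac : ∀ z, L z = (z - x s) * dslope L (x s) z := fun z => by
    have := sub_smul_dslope L (x s) z
    rw [hLs, sub_zero, smul_eq_mul] at this
    exact this.symm
  obtain ⟨A, -, -, hA⟩ := exists_antideriv_of_continuousOn_unitInterval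
    (hp.mul (hslope.comp_continuousOn hxc))
  have hw : ∀ t ∈ Icc (0:ℝ) 1, HasDerivWithinAt (fun t => (x t - x s) * Real.exp (-A t))
      (r t * Real.exp (-A t)) (Icc (0:ℝ) 1) t := fun t ht => by
    refine (((hx t ht).sub_const (x s)).mul (hA t ht).fun_neg.exp).congr_deriv ?_
    rw [hfac (x t)]
    simp only [Function.comp, Pi.mul_apply]
    ring
  obtain ⟨hmono, hlt⟩ := monotoneOn_and_lt_of_hasDerivWithinAt hw
    (fun t ht => mul_nonneg (hr t ht) (Real.exp_pos _).le) ht₀ (mul_pos hpos (Real.exp_pos _))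
  have h0 := hmono (by simp) hs hs.1
  have h1 := hmono hs (by simp) hs.2
  simp only [sub_self, zero_mul] at h0 h1
  have h0' : x 0 - x s ≤ 0 := nonpos_of_mul_nonpos_left h0 (Real.exp_pos _)
  have h1' : 0 ≤ x 1 - x s := nonneg_of_mul_nonneg_left h1 (Real.exp_pos _)
  by_contra! hle
  have e0 : x 0 - x s = 0 := by linarith
  have e1 : x 1 - x s = 0 := by linarith
  simp [e0, e1] at hlt

/-- If `L` is positive along a solution and `p` has nonnegative integral, then a nonnegative
forcing makes the solution increase. -/
theorem lt_of_forcing_nonneg_of_pos (hL : Continuous L)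
    (hp : ContinuousOn p (Icc (0:ℝ) 1))
    (hx : ∀ t ∈ Icc (0:ℝ) 1, HasDerivWithinAt x (p t * L (x t) + r t) (Icc (0:ℝ) 1) t)
    (hr : ∀ t ∈ Icc (0:ℝ) 1, 0 ≤ r t) {t₀ : ℝ} (ht₀ : t₀ ∈ Icc (0:ℝ) 1) (hpos : 0 < r t₀)
    (hLx : ∀ t ∈ Icc (0:ℝ) 1, 0 < L (x t)) (hP : 0 ≤ ∫ s in (0:ℝ)..1, p s) : x 0 < x 1 := by
  have hxc : ContinuousOn x (Icc (0:ℝ) 1) := fun t ht => (hx t ht).continuousWithinAt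
  obtain ⟨m, hm, hmin⟩ := isCompact_Icc.exists_isMinOn (nonempty_Icc.2 (zero_le_one' ℝ))
    (hL.comp_continuousOn hxc)
  have hδ : 0 < L (x m) := hLx m hm
  set g : ℝ → ℝ := fun z => (max (L z) (L (x m)))⁻¹
  have hgpos : ∀ z, 0 < g z := fun z => inv_pos.2 (lt_max_of_lt_right hδ)
  have hgc : Continuous g :=
    (hL.max continuous_const).inv₀ fun z => (lt_max_of_lt_right hδ).ne'
  have hgx : ∀ t ∈ Icc (0:ℝ) 1, g (x t) = (L (x t))⁻¹ := fun t ht => by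
    have : L (x m) ≤ L (x t) := hmin ht
    simp [g, max_eq_left this]
  have hG : ∀ z, HasDerivAt (fun z => ∫ u in (0:ℝ)..z, g u) (g z) z := fun z =>
    (hgc.integral_hasStrictDerivAt 0 z).hasDerivAt
  have hGmono : StrictMono (fun z => ∫ u in (0:ℝ)..z, g u) :=
    strictMono_of_hasDerivAt_pos hG hgpos
  obtain ⟨A, hA0, hA1, hA⟩ := exists_antideriv_of_continuousOn_unitInterval hp
  have hH : ∀ t ∈ Icc (0:ℝ) 1, HasDerivWithinAt (fun t => (∫ u in (0:ℝ)..x t, g u) - A t)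
      (r t * g (x t)) (Icc (0:ℝ) 1) t := fun t ht => by
    refine (((hG (x t)).comp_hasDerivWithinAt t (hx t ht)).sub (hA t ht)).congr_deriv ?_
    have := (hLx t ht).ne'
    rw [hgx t ht]
    field_simp
    ring
  have hlt := (monotoneOn_and_lt_of_hasDerivWithinAt hH
    (fun t ht => mul_nonneg (hr t ht) (hgpos _).le) ht₀ (mul_pos hpos (hgpos _))).2
  simp only [hA0, hA1] at hlt
  exact hGmono.lt_iff_lt.1 (by linarith)

/-- A solution of `x' = p L(x) + r` on `[0,1]` with nonnegative, not identically zero forcing `r`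
increases, provided `(∫ p) L` is nonnegative along it. -/
theorem lt_of_forcing_nonneg (hL : ContDiff ℝ 1 L) (hp : ContinuousOn p (Icc (0:ℝ) 1))
    (hx : ∀ t ∈ Icc (0:ℝ) 1, HasDerivWithinAt x (p t * L (x t) + r t) (Icc (0:ℝ) 1) t)
    (hr : ∀ t ∈ Icc (0:ℝ) 1, 0 ≤ r t) {t₀ : ℝ} (ht₀ : t₀ ∈ Icc (0:ℝ) 1) (hpos : 0 < r t₀)
    (hPL : ∀ t ∈ Icc (0:ℝ) 1, 0 ≤ (∫ s in (0:ℝ)..1, p s) * L (x t)) : x 0 < x 1 := by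
  by_cases hz : ∃ s ∈ Icc (0:ℝ) 1, L (x s) = 0
  · obtain ⟨s, hs, hLs⟩ := hz
    exact lt_of_forcing_nonneg_of_meets_zero hL hp hx hr ht₀ hpos hs hLs
  push Not at hz
  have hxc : ContinuousOn x (Icc (0:ℝ) 1) := fun t ht => (hx t ht).continuousWithinAt
  have hLxc : ContinuousOn (fun t => L (x t)) (Icc (0:ℝ) 1) := hL.continuous.comp_continuousOn hxc
  have hconn := isPreconnected_Icc (a := (0:ℝ)) (b := 1)
  have h0 : (0:ℝ) ∈ Icc (0:ℝ) 1 := by simp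
  rcases (hz 0 h0).lt_or_gt with hneg | hp0
  · have hLneg : ∀ t ∈ Icc (0:ℝ) 1, L (x t) < 0 := fun t ht => by
      by_contra! hge
      obtain ⟨s, hs, hs0⟩ := hconn.intermediate_value h0 ht hLxc ⟨hneg.le, hge⟩
      exact hz s hs hs0
    refine lt_of_forcing_nonneg_of_pos (L := -L) (p := -p) hL.continuous.neg hp.neg
      (fun t ht => ?_) hr ht₀ hpos (fun t ht => neg_pos.2 (hLneg t ht)) ?_
    · simpa using hx t ht
    · have := nonpos_of_mul_nonneg_left (hPL 0 h0) hneg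
      simpa using this
  · have hLpos : ∀ t ∈ Icc (0:ℝ) 1, 0 < L (x t) := fun t ht => by
      by_contra! hle
      obtain ⟨s, hs, hs0⟩ := hconn.intermediate_value ht h0 hLxc ⟨hle, hp0.le⟩
      exact hz s hs hs0
    exact lt_of_forcing_nonneg_of_pos hL.continuous hp hx hr ht₀ hpos hLpos
      (nonneg_of_mul_nonneg_left (hPL 0 h0) hp0)

end

theorem mul_nonneg_of_sign_mul_sign_nonneg {u v : ℝ} (h : 0 ≤ Real.sign u * Real.sign v) :
    0 ≤ u * v := by
  rcases lt_trichotomy u 0 with hu | rfl | hu <;> rcases lt_trichotomy v 0 with hv | rfl | hv <;>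
    first
    | simp
    | (simp only [Real.sign_of_neg, Real.sign_of_pos, hu, hv] at h; norm_num at h; done)
    | nlinarith

/-- Lemma 2.3 (ii): under the stated sign conditions, the equation
`dx/dt = p(t)·L(x) + q(x,t)` has no periodic solution with values in `(a,b)`, and every
solution staying in `(a,b)` satisfies `sgn(x(1) - x(0)) = sgn(q)` on `(a,b) × E`. -/
theorem perturbed_separable_no_periodic (L : ℝ → ℝ) (hL : ContDiff ℝ 1 L)
    (p : ℝ → ℝ) (hp : ContDiffOn ℝ 1 p (Set.Icc (0:ℝ) 1))
    (a b : ℝ) (hab : a < b) (hLab : L a = 0 ∨ L b = 0)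
    (E : Set ℝ) (hEne : E.Nonempty) (hEsub : E ⊆ Set.Icc (0:ℝ) 1)
    (hEopen : IsOpen {t : Set.Icc (0:ℝ) 1 | (t : ℝ) ∈ E})
    (q : ℝ → ℝ → ℝ)
    (hq : ContDiffOn ℝ 1 (fun P : ℝ × ℝ => q P.1 P.2) (Set.univ ×ˢ Set.Icc (0:ℝ) 1))
    (hqsign : (∀ z ∈ Set.Ioo a b, ∀ t ∈ Set.Icc (0:ℝ) 1, 0 ≤ q z t) ∨
              (∀ z ∈ Set.Ioo a b, ∀ t ∈ Set.Icc (0:ℝ) 1, q z t ≤ 0))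
    (hqne : ∀ z ∈ Set.Ioo a b, ∀ t ∈ E, q z t ≠ 0)
    (hsgn : ∀ z ∈ Set.Ioo a b, ∀ t ∈ E,
      0 ≤ Real.sign (∫ s in (0:ℝ)..1, p s) * Real.sign (L z) * Real.sign (q z t)) :
    (¬ ∃ x : ℝ → ℝ,
      (∀ t ∈ Set.Icc (0:ℝ) 1,
        HasDerivWithinAt x (p t * L (x t) + q (x t) t) (Set.Icc (0:ℝ) 1) t) ∧
      x 0 = x 1 ∧ (∀ t ∈ Set.Icc (0:ℝ) 1, x t ∈ Set.Ioo a b)) ∧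
    (∀ x : ℝ → ℝ,
      (∀ t ∈ Set.Icc (0:ℝ) 1,
        HasDerivWithinAt x (p t * L (x t) + q (x t) t) (Set.Icc (0:ℝ) 1) t) →
      (∀ t ∈ Set.Icc (0:ℝ) 1, x t ∈ Set.Ioo a b) →
      ∀ z ∈ Set.Ioo a b, ∀ t ∈ E, Real.sign (x 1 - x 0) = Real.sign (q z t)) := by
  have key : ∀ x : ℝ → ℝ,
      (∀ t ∈ Set.Icc (0:ℝ) 1,
        HasDerivWithinAt x (p t * L (x t) + q (x t) t) (Set.Icc (0:ℝ) 1) t) →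
      (∀ t ∈ Set.Icc (0:ℝ) 1, x t ∈ Set.Ioo a b) →
      ∀ z ∈ Set.Ioo a b, ∀ t ∈ E, Real.sign (x 1 - x 0) = Real.sign (q z t) := by
    intro x hx hxab z hz t ht
    have htI := hEsub ht
    rcases hqsign with hq0 | hq0
    · have hqpos : ∀ z ∈ Ioo a b, 0 < q z t := fun z hz =>
        (hq0 z hz t htI).lt_of_ne (hqne z hz t ht).symm
      have hlt : x 0 < x 1 := lt_of_forcing_nonneg hL hp.continuousOn hx
        (fun s hs => hq0 _ (hxab s hs) s hs) htI (hqpos _ (hxab t htI)) fun s hs => by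
          have h := hsgn _ (hxab s hs) t ht
          rw [Real.sign_of_pos (hqpos _ (hxab s hs)), mul_one] at h
          exact mul_nonneg_of_sign_mul_sign_nonneg h
      rw [Real.sign_of_pos (sub_pos.2 hlt), Real.sign_of_pos (hqpos z hz)]
    · have hqneg : ∀ z ∈ Ioo a b, q z t < 0 := fun z hz =>
        (hq0 z hz t htI).lt_of_ne (hqne z hz t ht)
      have hlt : -x 0 < -x 1 := lt_of_forcing_nonneg (L := fun z => -L (-z)) (x := fun s => -x s)
        (r := fun s => -q (x s) s) (hL.comp contDiff_neg).neg hp.continuousOn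
        (fun s hs => by
          refine (hx s hs).fun_neg.congr_deriv ?_
          simp only [neg_neg]
          ring)
        (fun s hs => neg_nonneg.2 (hq0 _ (hxab s hs) s hs)) htI
        (neg_pos.2 (hqneg _ (hxab t htI))) fun s hs => by
          have h := hsgn _ (hxab s hs) t ht
          rw [Real.sign_of_neg (hqneg _ (hxab s hs)), mul_neg_one, ← mul_neg, ← Real.sign_neg] at h
          simpa only [neg_neg] using mul_nonneg_of_sign_mul_sign_nonneg h
      rw [Real.sign_of_neg (by linarith), Real.sign_of_neg (hqneg z hz)]
  refine ⟨?_, key⟩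
  rintro ⟨x, hx, hper, hxab⟩
  obtain ⟨t, ht⟩ := hEne
  have hz := hxab 0 (by simp)
  have h := key x hx hxab _ hz t ht
  rw [hper, sub_self, Real.sign_zero, eq_comm, Real.sign_eq_zero_iff, ← hper] at h
  exact hqne _ hz t ht h
end

section
/- Assume equation (1) satisfies Hypothesis (H) and S(\lambda_i,t) = 0 for all t \in [0,1] and all i = 1,\ldots,m, so that S(x,t) = a_m(t) f(x) with f(x) = \prod_{i=1}^m (x - \lambda_i). Then: (a) if \int_0^1 a_m(t)\,dt = 0, every solution of (1) that is defined on all of [0,1] is periodic, and (1) has no isolated periodic solutions; (b) if \int_0^1 a_m(t)\,dt \ne 0, the periodic solutions of (1) are exactly the m constants x \equiv \lambda_1, \ldots, x \equiv \lambda_m, each of which is hyperbolic, i.e., f'(\lambda_i) \int_0^1 a_m(t)\,dt \ne 0, and hence (1) has exactly m isolated periodic solutions. -/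
open Set

/-- An isolated periodic solution. -/
def IsIsolatedPeriodicSol (S : ℝ → ℝ → ℝ) (x : ℝ → ℝ) : Prop :=
  IsPeriodicSol S x ∧
    ∃ ε > 0, ∀ y : ℝ → ℝ, IsPeriodicSol S y → |y 0 - x 0| < ε → y 0 = x 0

/-- A solution of a linear equation `dh/dt = b h` on `[0,1]` is its initial value times a nowhere
vanishing function. -/
lemma linear_ode_eq {b h : ℝ → ℝ} (hb : ContinuousOn b (Icc 0 1))
    (hh : ∀ t ∈ Icc (0:ℝ) 1, HasDerivWithinAt h (b t * h t) (Icc 0 1) t) :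
    ∃ E : ℝ → ℝ, (∀ t, E t ≠ 0) ∧ ∀ t ∈ Icc (0:ℝ) 1, h t = h 0 * E t := by
  set β : ℝ → ℝ := IccExtend zero_le_one ((Icc (0:ℝ) 1).domRestrict b)
  have hβc : Continuous β := (continuousOn_iff_continuous_domRestrict.1 hb).Icc_extend'
  have hβb : ∀ t ∈ Icc (0:ℝ) 1, β t = b t := fun t ht => IccExtend_of_mem _ _ ht
  set B : ℝ → ℝ := fun t => ∫ s in (0:ℝ)..t, β s
  have hB : ∀ t, HasDerivAt B (β t) t := fun t => hβc.integral_hasStrictDerivAt 0 t |>.hasDerivAt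
  have hd : ∀ t ∈ Icc (0:ℝ) 1,
      HasDerivWithinAt (fun t => h t * Real.exp (-B t)) 0 (Icc 0 1) t := by
    intro t ht
    have := (hh t ht).mul (hB t).neg.exp.hasDerivWithinAt
    refine this.congr_deriv ?_
    rw [hβb t ht]; simp only [Pi.neg_apply]; ring
  have hconst := constant_of_derivWithin_zero (fun t ht => (hd t ht).differentiableWithinAt)
    (fun t ht => (hd t (Ico_subset_Icc_self ht)).derivWithin
      (uniqueDiffOn_Icc zero_lt_one t (Ico_subset_Icc_self ht)))
  refine ⟨fun t => Real.exp (B t), fun t => (Real.exp_pos _).ne', fun t ht => ?_⟩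
  have h1 := hconst t ht
  have hB0 : B 0 = 0 := intervalIntegral.integral_same
  simp only [hB0, neg_zero, Real.exp_zero, mul_one] at h1
  rw [← h1, mul_assoc, ← Real.exp_add]; simp

/-- A solution of `dx/dt = α(t) f(x)` on `[0,1]` with `f` of class `C¹` is not alone: there are
other solutions on all of `[0,1]` with initial value arbitrarily close to it. -/
lemma exists_nearby_solution {α f x : ℝ → ℝ} (hα : ContinuousOn α (Icc 0 1))
    (hf : ContDiff ℝ 1 f)
    (hx : ∀ t ∈ Icc (0:ℝ) 1, HasDerivWithinAt x (α t * f (x t)) (Icc 0 1) t)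
    {δ : ℝ} (hδ : 0 < δ) :
    ∃ y : ℝ → ℝ, (∀ t ∈ Icc (0:ℝ) 1, HasDerivWithinAt y (α t * f (y t)) (Icc 0 1) t) ∧
      |y 0 - x 0| < δ ∧ y 0 ≠ x 0 := by
  have hxc : ContinuousOn x (Icc 0 1) := fun t ht => (hx t ht).continuousWithinAt
  obtain ⟨M, hM⟩ := isCompact_Icc.exists_bound_of_continuousOn hxc
  obtain ⟨N, hN⟩ := isCompact_Icc.exists_bound_of_continuousOn hα
  have hM0 : 0 ≤ M := (norm_nonneg _).trans (hM 0 (by simp))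
  have hN0 : 0 ≤ N := (norm_nonneg _).trans (hN 0 (by simp))
  let φ : ContDiffBump (0:ℝ) := ⟨M + 1, M + 2, by linarith, by linarith⟩
  set g : ℝ → ℝ := fun u => φ u * f u
  have hgs : HasCompactSupport g := φ.hasCompactSupport.mul_right
  have hgd : ContDiff ℝ 1 g := φ.contDiff.mul hf
  obtain ⟨K, hK⟩ := hgd.lipschitzWith_of_hasCompactSupport hgs one_ne_zero
  obtain ⟨C, hC⟩ := hgs.exists_bound_of_continuous hgd.continuous
  have hC0 : 0 ≤ C := (norm_nonneg _).trans (hC 0)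
  have hgf : ∀ u, |u| ≤ M + 1 → g u = f u := by
    intro u hu
    have : φ u = 1 := φ.one_of_mem_closedBall (by simpa [φ] using hu)
    simp [g, this]
  lift N to NNReal using hN0
  lift C to NNReal using hC0
  have hlip : ∀ t ∈ Icc (0:ℝ) 1, LipschitzWith (N * K) (fun u => α t * g u) := by
    intro t ht
    refine LipschitzWith.of_dist_le_mul fun u w => ?_
    rw [Real.dist_eq, ← mul_sub, abs_mul, NNReal.coe_mul, mul_assoc]
    have := hK.dist_le_mul u w
    rw [Real.dist_eq] at this
    exact mul_le_mul (hN t ht) this (abs_nonneg _) N.2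
  set L : ℝ := Real.exp ((N * K : NNReal) * 1)
  set η : ℝ := min (δ / 2) (1 / L)
  have hL : 0 < L := Real.exp_pos _
  have hη : 0 < η := lt_min (by linarith) (by positivity)
  have hpl : IsPicardLindelof (fun t u => α t * g u) (⟨0, by simp⟩ : Icc (0:ℝ) 1) (x 0 + η)
      (N * C) 0 (N * C) (N * K) := by
    refine ⟨fun t ht => (hlip t ht).lipschitzOnWith, fun u _ => hα.mul continuousOn_const,
      fun t ht u _ => ?_, by simp⟩
    rw [norm_mul, NNReal.coe_mul]
    exact mul_le_mul (hN t ht) (hC u) (norm_nonneg _) N.2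
  obtain ⟨y, hy0, hy⟩ := hpl.exists_eq_forall_mem_Icc_hasDerivWithinAt₀
  simp only at hy0
  have hright : ∀ {z : ℝ → ℝ} {d : ℝ → ℝ},
      (∀ t ∈ Icc (0:ℝ) 1, HasDerivWithinAt z (d t) (Icc 0 1) t) →
      ∀ t ∈ Ico (0:ℝ) 1, HasDerivWithinAt z (d t) (Ici t) t := fun hz t ht =>
    (hz t (Ico_subset_Icc_self ht)).mono_of_mem_nhdsWithin (Icc_mem_nhdsGE_of_mem ht)
  have hdist : ∀ t ∈ Icc (0:ℝ) 1, |y t - x t| ≤ 1 := by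
    intro t ht
    have := dist_le_of_trajectories_ODE_of_mem (v := fun t u => α t * g u) (s := fun _ => univ)
      (δ := η) (fun t ht => (hlip t (Ico_subset_Icc_self ht)).lipschitzOnWith)
      (fun t ht => (hy t ht).continuousWithinAt) (hright hy) (fun _ _ => mem_univ _) hxc
      (fun t ht => by
        have h1 := hM t (Ico_subset_Icc_self ht)
        rw [Real.norm_eq_abs] at h1
        simpa only [hgf (x t) (by linarith)] using hright hx t ht) (fun _ _ => mem_univ _)
      (by rw [hy0, Real.dist_eq]; simp [abs_of_pos hη]) t ht
    rw [Real.dist_eq] at this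
    refine this.trans ?_
    calc η * Real.exp ((N * K : NNReal) * (t - 0)) ≤ (1 / L) * L := by
          refine mul_le_mul (min_le_right _ _) ?_ (Real.exp_pos _).le (by positivity)
          refine Real.exp_le_exp.2 (mul_le_mul_of_nonneg_left ?_ (NNReal.coe_nonneg _))
          linarith [ht.2]
      _ = 1 := by field_simp
  refine ⟨y, fun t ht => ?_, ?_, ?_⟩
  · have h1 := hM t ht
    have h2 := hdist t ht
    have h3 := abs_add_le (y t - x t) (x t)
    rw [Real.norm_eq_abs] at h1
    rw [sub_add_cancel] at h3
    simpa only [hgf (y t) (by linarith)] using hy t ht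
  · rw [hy0, add_sub_cancel_left, abs_of_pos hη]
    exact (min_le_left _ _).trans_lt (by linarith)
  · rw [hy0]; linarith

/-- Separation of variables for `dx/dt = α(t) f(x)` along a solution avoiding the zeros of `f`. -/
lemma integral_inv_eq {α f x : ℝ → ℝ} (hα : ContinuousOn α (Icc 0 1)) (hf : Continuous f)
    (hx : ∀ t ∈ Icc (0:ℝ) 1, HasDerivWithinAt x (α t * f (x t)) (Icc 0 1) t)
    (hne : ∀ t ∈ Icc (0:ℝ) 1, f (x t) ≠ 0) :
    (∫ t in (0:ℝ)..1, α t) = ∫ u in x 0..x 1, (f u)⁻¹ := by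
  have hxc : ContinuousOn x (Icc 0 1) := fun t ht => (hx t ht).continuousWithinAt
  have hu : uIcc (0:ℝ) 1 = Icc 0 1 := uIcc_of_le zero_le_one
  rw [← intervalIntegral.integral_comp_mul_deriv'' (f := x) (f' := fun t => α t * f (x t))]
  · refine intervalIntegral.integral_congr fun t ht => ?_
    have := hne t (hu ▸ ht)
    simp only [Function.comp]
    field_simp
  · rwa [hu]
  · intro t ht
    rw [min_eq_left zero_le_one, max_eq_right zero_le_one] at ht
    exact ((hx t (Ioo_subset_Icc_self ht)).hasDerivAt (Icc_mem_nhds ht.1 ht.2)).hasDerivWithinAt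
  · rw [hu]; exact hα.mul (hf.comp_continuousOn hxc)
  · rw [hu]
    refine hf.continuousOn.inv₀ ?_
    rintro _ ⟨t, ht, rfl⟩
    exact hne t ht

/-- If `∫ α = 0`, a solution of `dx/dt = α(t) f(x)` avoiding the zeros of `f` is periodic. -/
lemma endpoints_eq_of_integral_eq_zero {α f x : ℝ → ℝ} (hα : ContinuousOn α (Icc 0 1))
    (hf : Continuous f)
    (hx : ∀ t ∈ Icc (0:ℝ) 1, HasDerivWithinAt x (α t * f (x t)) (Icc 0 1) t)
    (hne : ∀ t ∈ Icc (0:ℝ) 1, f (x t) ≠ 0) (h0 : (∫ t in (0:ℝ)..1, α t) = 0) :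
    x 0 = x 1 := by
  by_contra hxx
  have hxc : ContinuousOn x (uIcc 0 1) := by
    rw [uIcc_of_le zero_le_one]; exact fun t ht => (hx t ht).continuousWithinAt
  have hne' : ∀ u ∈ uIcc (x 0) (x 1), f u ≠ 0 := by
    intro u hu
    obtain ⟨t, ht, rfl⟩ := intermediate_value_uIcc hxc hu
    exact hne t (uIcc_of_le (zero_le_one (α := ℝ)) ▸ ht)
  obtain ⟨c, hc, hceq⟩ := exists_eq_interval_average hxx (hf.continuousOn.inv₀ hne')
  rw [interval_average_eq] at hceq
  simp only [Pi.inv_apply] at hceq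
  rw [← integral_inv_eq hα hf hx hne, h0, smul_zero] at hceq
  exact hne' c (uIoo_subset_uIcc_self hc) (inv_eq_zero.1 hceq)

open Polynomial in
/-- A polynomial function of degree at most `m` with `m` distinct roots is its coefficient of
degree `m` times the product of the linear factors. -/
lemma sum_eq_leading_mul_prod {m : ℕ} (c : ℕ → ℝ) {lam : ℕ → ℝ}
    (hinj : InjOn lam (Finset.Icc 1 m))
    (hz : ∀ i ∈ Finset.Icc 1 m, ∑ j ∈ Finset.range (m + 1), c j * lam i ^ j = 0) (x : ℝ) :
    ∑ j ∈ Finset.range (m + 1), c j * x ^ j = c m * ∏ i ∈ Finset.Icc 1 m, (x - lam i) := by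
  set P : ℝ[X] := ∑ j ∈ Finset.range (m + 1), C (c j) * X ^ j
  set Q : ℝ[X] := ∏ i ∈ Finset.Icc 1 m, (X - C (lam i))
  have hP : ∀ y, P.eval y = ∑ j ∈ Finset.range (m + 1), c j * y ^ j := by
    intro y; simp [P, eval_finsetSum]
  have hQ : ∀ y, Q.eval y = ∏ i ∈ Finset.Icc 1 m, (y - lam i) := by
    intro y; simp [Q, eval_prod]
  have hQm : Q.Monic := monic_prod_of_monic _ _ fun i _ => monic_X_sub_C _
  have hQd : Q.natDegree = m := by simp [Q, natDegree_finsetProd_X_sub_C_eq_card]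
  have hdeg : (P - C (c m) * Q).degree < ((Finset.Icc 1 m).image lam).card := by
    rw [Finset.card_image_of_injOn hinj, Nat.card_Icc, Nat.add_sub_cancel, degree_lt_iff_coeff_zero]
    intro k hk
    rw [coeff_sub, coeff_C_mul]
    rcases hk.eq_or_lt with rfl | hk
    · have : Q.coeff m = 1 := by simpa [hQd] using hQm.coeff_natDegree
      simp [P, this, coeff_X_pow]
    · rw [coeff_eq_zero_of_natDegree_lt (p := Q) (by rwa [hQd])]
      simp only [P, finsetSum_coeff, coeff_C_mul, coeff_X_pow, mul_zero, sub_zero]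
      refine Finset.sum_eq_zero fun j hj => ?_
      rw [if_neg (by have := Finset.mem_range.1 hj; omega), mul_zero]
  have hzero := Polynomial.eq_zero_of_degree_lt_of_eval_finset_eq_zero _ hdeg (by
    intro y hy
    obtain ⟨i, hi, rfl⟩ := Finset.mem_image.1 hy
    rw [eval_sub, eval_mul, hP, hz i hi, hQ, Finset.prod_eq_zero hi (sub_self _)]
    simp)
  have := congrArg (eval x) hzero
  rw [eval_sub, eval_mul, hP, hQ, eval_C, eval_zero] at this
  linarith

/-- A product of distinct linear factors has simple zeros. -/
lemma deriv_prod_sub_ne_zero {s : Finset ℕ} {lam : ℕ → ℝ} (hinj : InjOn lam s) {i : ℕ}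
    (hi : i ∈ s) : deriv (fun x => ∏ j ∈ s, (x - lam j)) (lam i) ≠ 0 := by
  have hg : DifferentiableAt ℝ (fun x => ∏ j ∈ s.erase i, (x - lam j)) (lam i) := by fun_prop
  have h1 : (fun x => ∏ j ∈ s, (x - lam j)) =
      fun x => (x - lam i) * ∏ j ∈ s.erase i, (x - lam j) := by
    ext x; rw [Finset.mul_prod_erase s (fun j => x - lam j) hi]
  have h2 := ((hasDerivAt_id (lam i)).sub_const (lam i)).mul hg.hasDerivAt
  rw [h1, HasDerivAt.deriv (f := fun x => (x - lam i) * ∏ j ∈ s.erase i, (x - lam j)) h2]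
  simp only [id, sub_self, zero_mul, add_zero, one_mul]
  refine Finset.prod_ne_zero_iff.2 fun j hj => sub_ne_zero.2 fun h => ?_
  exact Finset.ne_of_mem_erase hj (hinj (Finset.mem_of_mem_erase hj) hi h.symm)

/-- A solution of `dx/dt = α(t) ∏ (x - lam i)` that meets a root is constantly equal to that root. -/
lemma exists_eq_root_of_prod_eq_zero {s : Finset ℕ} {lam : ℕ → ℝ} {α x : ℝ → ℝ}
    (hα : ContinuousOn α (Icc 0 1))
    (hx : ∀ t ∈ Icc (0:ℝ) 1,
      HasDerivWithinAt x (α t * ∏ i ∈ s, (x t - lam i)) (Icc 0 1) t)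
    {t₀ : ℝ} (ht₀ : t₀ ∈ Icc (0:ℝ) 1) (h0 : ∏ i ∈ s, (x t₀ - lam i) = 0) :
    ∃ i ∈ s, ∀ t ∈ Icc (0:ℝ) 1, x t = lam i := by
  obtain ⟨i, hi, hxi⟩ := Finset.prod_eq_zero_iff.1 h0
  have hxc : ContinuousOn x (Icc 0 1) := fun t ht => (hx t ht).continuousWithinAt
  obtain ⟨E, hE, hxE⟩ := linear_ode_eq (h := fun t => x t - lam i)
    (b := fun t => α t * ∏ j ∈ s.erase i, (x t - lam j))
    (hα.mul (continuousOn_finsetProd _ fun j _ => hxc.sub continuousOn_const))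
    (fun t ht => ((hx t ht).sub_const (lam i)).congr_deriv (by
      rw [← Finset.mul_prod_erase s (fun j => x t - lam j) hi]; ring))
  refine ⟨i, hi, fun t ht => ?_⟩
  have h1 := hxE t₀ ht₀
  simp only [hxi] at h1
  have h2 := hxE t ht
  simp only [(mul_eq_zero.1 h1.symm).resolve_right (hE t₀), zero_mul] at h2
  exact sub_eq_zero.1 h2

/-- Finitely many real numbers, except those equal to `c`, keep a positive distance from `c`. -/
lemma exists_pos_forall_abs_sub_lt_imp_eq (s : Finset ℕ) (lam : ℕ → ℝ) (c : ℝ) :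
    ∃ ε > 0, ∀ i ∈ s, |lam i - c| < ε → lam i = c := by
  have hfin : ((s.image lam).erase c : Set ℝ).Finite := Finset.finite_toSet _
  obtain ⟨ε, hε, hball⟩ := Metric.isOpen_iff.1 hfin.isClosed.isOpen_compl c (by simp)
  refine ⟨ε, hε, fun i hi h => ?_⟩
  by_contra hne
  refine hball (Metric.mem_ball.2 (Real.dist_eq _ _ ▸ h)) ?_
  simp only [Finset.coe_erase, Finset.coe_image, mem_sdiff, mem_singleton_iff]
  exact ⟨mem_image_of_mem _ hi, hne⟩

/-- Proposition 2.4 (i): under Hypothesis (H) with all `S(λᵢ,·) ≡ 0`, one has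
`S(x,t) = a_m(t)·f(x)` with `f(x) = ∏ᵢ (x - λᵢ)`; if `∫₀¹ a_m = 0`, every solution
defined on `[0,1]` is periodic and there is no isolated periodic solution; if
`∫₀¹ a_m ≠ 0`, the periodic solutions are exactly the `m` constants `λ₁, …, λ_m`,
each hyperbolic, so there are exactly `m` isolated periodic solutions. -/
theorem abel_all_zero_dichotomy (m : ℕ) (hm : 1 ≤ m) (a : ℕ → ℝ → ℝ)
    (ha : ∀ i ≤ m, ContDiffOn ℝ (⊤ : ℕ∞) (a i) (Set.Icc (0:ℝ) 1))
    (S : ℝ → ℝ → ℝ)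
    (hS : ∀ x t, S x t = ∑ i ∈ Finset.range (m + 1), a i t * x ^ i)
    (lam : ℕ → ℝ)
    (hlt : ∀ i j, 1 ≤ i → i < j → j ≤ m → lam i < lam j)
    (hzero : ∀ i, 1 ≤ i → i ≤ m → ∀ t ∈ Set.Icc (0:ℝ) 1, S (lam i) t = 0)
    (f : ℝ → ℝ) (hf : ∀ x, f x = ∏ i ∈ Finset.Icc 1 m, (x - lam i)) :
    (∀ t ∈ Set.Icc (0:ℝ) 1, ∀ x : ℝ, S x t = a m t * f x) ∧
    ((∫ t in (0:ℝ)..1, a m t) = 0 →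
      (∀ x : ℝ → ℝ,
        (∀ t ∈ Set.Icc (0:ℝ) 1, HasDerivWithinAt x (S (x t) t) (Set.Icc (0:ℝ) 1) t) →
        x 0 = x 1) ∧
      (∀ x : ℝ → ℝ, ¬ IsIsolatedPeriodicSol S x)) ∧
    ((∫ t in (0:ℝ)..1, a m t) ≠ 0 →
      (∀ x : ℝ → ℝ, IsPeriodicSol S x ↔
        ∃ i, 1 ≤ i ∧ i ≤ m ∧ ∀ t ∈ Set.Icc (0:ℝ) 1, x t = lam i) ∧
      (∀ i, 1 ≤ i → i ≤ m → deriv f (lam i) * (∫ t in (0:ℝ)..1, a m t) ≠ 0) ∧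
      {x0 : ℝ | ∃ x : ℝ → ℝ, IsIsolatedPeriodicSol S x ∧ x 0 = x0} =
        {x0 : ℝ | ∃ i, 1 ≤ i ∧ i ≤ m ∧ x0 = lam i} ∧
      {x0 : ℝ | ∃ x : ℝ → ℝ, IsIsolatedPeriodicSol S x ∧ x 0 = x0}.ncard = m) := by
  have hI : ∀ {i}, i ∈ Finset.Icc 1 m ↔ 1 ≤ i ∧ i ≤ m := Finset.mem_Icc
  have hinj : InjOn lam (Finset.Icc 1 m) := by
    intro i hi j hj hij
    rw [Finset.mem_coe, hI] at hi hj
    rcases lt_trichotomy i j with h | h | h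
    · exact absurd hij (hlt i j hi.1 h hj.2).ne
    · exact h
    · exact absurd hij (hlt j i hj.1 h hi.2).ne'
  have hα : ContinuousOn (a m) (Icc 0 1) := (ha m le_rfl).continuousOn
  have hfeq : f = fun x => ∏ i ∈ Finset.Icc 1 m, (x - lam i) := funext hf
  have hfd : ContDiff ℝ 1 f := by
    rw [hfeq]; exact contDiff_prod fun i _ => contDiff_id.sub contDiff_const
  have hSf : ∀ t ∈ Icc (0:ℝ) 1, ∀ x : ℝ, S x t = a m t * f x := by
    intro t ht x
    rw [hS, hf]
    refine sum_eq_leading_mul_prod (fun j => a j t) hinj (fun i hi => ?_) x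
    rw [← hS]
    exact hzero i (hI.1 hi).1 (hI.1 hi).2 t ht
  have hsol : ∀ {x : ℝ → ℝ},
      (∀ t ∈ Icc (0:ℝ) 1, HasDerivWithinAt x (S (x t) t) (Icc (0:ℝ) 1) t) ↔
      ∀ t ∈ Icc (0:ℝ) 1, HasDerivWithinAt x (a m t * f (x t)) (Icc (0:ℝ) 1) t := by
    intro x
    refine forall₂_congr fun t ht => ?_
    rw [hSf t ht]
  have hroot : ∀ {x : ℝ → ℝ} {t₀ : ℝ},
      (∀ t ∈ Icc (0:ℝ) 1, HasDerivWithinAt x (a m t * f (x t)) (Icc (0:ℝ) 1) t) →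
      t₀ ∈ Icc (0:ℝ) 1 → f (x t₀) = 0 →
      ∃ i ∈ Finset.Icc 1 m, ∀ t ∈ Icc (0:ℝ) 1, x t = lam i := fun hx ht₀ h0 =>
    exists_eq_root_of_prod_eq_zero hα (by simpa only [hf] using hx) ht₀ (by rwa [← hf])
  have h01 : (0:ℝ) ∈ Icc (0:ℝ) 1 := by simp
  have h11 : (1:ℝ) ∈ Icc (0:ℝ) 1 := by simp
  refine ⟨hSf, fun hint => ?_, fun hint => ?_⟩
  · have hper : ∀ x : ℝ → ℝ,
        (∀ t ∈ Icc (0:ℝ) 1, HasDerivWithinAt x (S (x t) t) (Icc (0:ℝ) 1) t) → x 0 = x 1 := by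
      intro x hx
      rw [hsol] at hx
      by_cases h : ∃ t₀ ∈ Icc (0:ℝ) 1, f (x t₀) = 0
      · obtain ⟨t₀, ht₀, h0⟩ := h
        obtain ⟨i, -, hi⟩ := hroot hx ht₀ h0
        rw [hi 0 h01, hi 1 h11]
      · push Not at h
        exact endpoints_eq_of_integral_eq_zero hα hfd.continuous hx h hint
    refine ⟨hper, ?_⟩
    rintro x ⟨⟨hx, -⟩, ε, hε, hiso⟩
    obtain ⟨y, hy, hlt, hne⟩ := exists_nearby_solution hα hfd (hsol.1 hx) hε
    exact hne (hiso y ⟨hsol.2 hy, hper y (hsol.2 hy)⟩ hlt)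
  · have hiff : ∀ x : ℝ → ℝ, IsPeriodicSol S x ↔
        ∃ i, 1 ≤ i ∧ i ≤ m ∧ ∀ t ∈ Icc (0:ℝ) 1, x t = lam i := by
      intro x
      constructor
      · rintro ⟨hx, h0⟩
        rw [hsol] at hx
        by_cases h : ∃ t₀ ∈ Icc (0:ℝ) 1, f (x t₀) = 0
        · obtain ⟨t₀, ht₀, hz⟩ := h
          obtain ⟨i, hi, hxi⟩ := hroot hx ht₀ hz
          exact ⟨i, (hI.1 hi).1, (hI.1 hi).2, hxi⟩
        · push Not at h
          refine absurd ?_ hint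
          rw [integral_inv_eq hα hfd.continuous hx h, h0, intervalIntegral.integral_same]
      · rintro ⟨i, hi1, him, hx⟩
        refine ⟨fun t ht => ?_, by rw [hx 0 h01, hx 1 h11]⟩
        rw [hx t ht, hzero i hi1 him t ht]
        exact (hasDerivWithinAt_const t _ (lam i)).congr hx (hx t ht)
    have hset : {x0 : ℝ | ∃ x : ℝ → ℝ, IsIsolatedPeriodicSol S x ∧ x 0 = x0} =
        {x0 : ℝ | ∃ i, 1 ≤ i ∧ i ≤ m ∧ x0 = lam i} := by
      ext x0
      constructor
      · rintro ⟨x, ⟨hx, -⟩, rfl⟩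
        obtain ⟨i, hi1, him, hxi⟩ := (hiff x).1 hx
        exact ⟨i, hi1, him, hxi 0 h01⟩
      · rintro ⟨i, hi1, him, rfl⟩
        obtain ⟨ε, hε, hsep⟩ := exists_pos_forall_abs_sub_lt_imp_eq (Finset.Icc 1 m) lam (lam i)
        refine ⟨fun _ => lam i, ⟨(hiff _).2 ⟨i, hi1, him, fun _ _ => rfl⟩, ε, hε, ?_⟩, rfl⟩
        intro y hy hlt
        obtain ⟨j, hj1, hjm, hyj⟩ := (hiff y).1 hy
        rw [hyj 0 h01] at hlt ⊢
        exact hsep j (hI.2 ⟨hj1, hjm⟩) hlt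
    refine ⟨hiff, fun i hi1 him => ?_, hset, ?_⟩
    · rw [hfeq]
      exact mul_ne_zero (deriv_prod_sub_ne_zero hinj (hI.2 ⟨hi1, him⟩)) hint
    · have himg : {x0 : ℝ | ∃ i, 1 ≤ i ∧ i ≤ m ∧ x0 = lam i} =
          ((Finset.Icc 1 m).image lam : Finset ℝ) := by
        ext x0
        simp only [mem_ofPred_eq, Finset.coe_image, mem_image, Finset.mem_coe, hI, and_assoc,
          eq_comm]
      rw [hset, himg, ncard_coe_finset, Finset.card_image_of_injOn hinj]
      simp
end

section
/- Consider the equation dx/dt = S(x,t) = (1 + 5\cos(2\pi t))x^3 - 15\cos(2\pi t)x^2 - (4 + 5\cos(2\pi t))x + 15\cos(2\pi t) on [0,1]. Then S(-1,t) = 3 > 0, S(1,t) = -3 < 0 and S(3,t) = 15 > 0 for all t, so the equation satisfies Hypothesis (H) with \lambda_1 = -1, \lambda_2 = 1, \lambda_3 = 3; consequently it has at most 3 isolated periodic solutions, and it has at least 2 periodic solutions, one taking values in the interval (-1,1) and one taking values in the interval (1,3). -/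
open Set

/-- Hypothesis (H). -/
def HypH (m : ℕ) (S : ℝ → ℝ → ℝ) : Prop :=
  ∃ lam : ℕ → ℝ,
    (∀ i j, 1 ≤ i → i < j → j ≤ m → lam i < lam j) ∧
    ((∀ i, 1 ≤ i → i ≤ m → ∀ t ∈ Set.Icc (0:ℝ) 1, 0 ≤ (-1:ℝ) ^ i * S (lam i) t) ∨
     (∀ i, 1 ≤ i → i ≤ m → ∀ t ∈ Set.Icc (0:ℝ) 1, (-1:ℝ) ^ i * S (lam i) t ≤ 0))

open scoped NNReal Topology

/-- Solutions cannot cross downwards a level on which the vector field is positive. -/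
lemma le_of_vectorField_pos {V : ℝ → ℝ → ℝ} {x : ℝ → ℝ} {c s : ℝ}
    (hx : ∀ t ∈ Icc (0:ℝ) 1, HasDerivWithinAt x (V (x t) t) (Icc (0:ℝ) 1) t)
    (hV : ∀ t ∈ Icc (0:ℝ) 1, 0 < V c t) (hs : s ∈ Icc (0:ℝ) 1) (hxs : c ≤ x s) :
    ∀ t ∈ Icc s 1, c ≤ x t := by
  have hsub : Icc s 1 ⊆ Icc (0:ℝ) 1 := Icc_subset_Icc_left hs.1
  have key := image_le_of_deriv_right_lt_deriv_boundary' (a := s) (b := 1)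
    (f := fun t => -x t) (f' := fun t => -V (x t) t) (B := fun _ => -c) (B' := fun _ => 0)
    (fun t ht => ((hx t (hsub ht)).continuousWithinAt.mono hsub).neg)
    (fun t ht => ((hx t (hsub ⟨ht.1, ht.2.le⟩)).mono_of_mem_nhdsWithin
      (Filter.mem_of_superset (Icc_mem_nhdsGE ht.2)
        (Icc_subset_Icc_left (hs.1.trans ht.1)))).neg)
    (by simpa using hxs) continuousOn_const (fun t _ => hasDerivWithinAt_const _ _ _)
    (fun t ht h => by
      have : x t = c := by simpa using h
      simpa [this] using hV t (hsub ⟨ht.1, ht.2.le⟩))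
  intro t ht
  simpa using key ht

/-- A function bounded below by its value at the right end of an interval has nonpositive
left derivative there. -/
lemma deriv_nonpos_of_le {x : ℝ → ℝ} {d t : ℝ} (ht : t ∈ Ioc (0:ℝ) 1)
    (hx : HasDerivWithinAt x d (Icc (0:ℝ) 1) t) (hmin : ∀ s ∈ Icc (0:ℝ) 1, x t ≤ x s) :
    d ≤ 0 := by
  have h1 : HasDerivWithinAt x d (Ico 0 t) t :=
    hx.mono (fun s hs => ⟨hs.1, hs.2.le.trans ht.2⟩)
  rw [hasDerivWithinAt_iff_tendsto_slope' (by simp)] at h1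
  have : (𝓝[Ico 0 t] t).NeBot := by
    rw [nhdsWithin_Ico_eq_nhdsLT ht.1]; infer_instance
  refine le_of_tendsto h1 ?_
  filter_upwards [self_mem_nhdsWithin] with s hs
  rw [slope_def_field]
  exact div_nonpos_of_nonneg_of_nonpos
    (sub_nonneg.2 (hmin s ⟨hs.1, hs.2.le.trans ht.2⟩)) (sub_nonpos.2 hs.2.le)

lemma IsPeriodicSol.lt_of_exists_le {V : ℝ → ℝ → ℝ} {x : ℝ → ℝ} {c : ℝ}
    (hx : IsPeriodicSol V x) (hV : ∀ t ∈ Icc (0:ℝ) 1, 0 < V c t)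
    (h : ∃ s ∈ Icc (0:ℝ) 1, c ≤ x s) : ∀ t ∈ Icc (0:ℝ) 1, c < x t := by
  obtain ⟨s, hs, hxs⟩ := h
  have h1 : c ≤ x 1 := le_of_vectorField_pos hx.1 hV hs hxs 1 ⟨hs.2, le_rfl⟩
  have hall := le_of_vectorField_pos hx.1 hV (s := 0) (by simp) (hx.2 ▸ h1)
  have hpos : ∀ t ∈ Ioc (0:ℝ) 1, c < x t := by
    intro t ht
    have ht' : t ∈ Icc (0:ℝ) 1 := ⟨ht.1.le, ht.2⟩
    refine lt_of_le_of_ne (hall t ht') fun he => ?_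
    have hd := deriv_nonpos_of_le ht (hx.1 t ht') (fun r hr => he ▸ hall r hr)
    rw [← he] at hd
    exact absurd hd (not_le.2 (hV t ht'))
  intro t ht
  rcases ht.1.eq_or_lt with h0 | h0
  · rw [← h0, hx.2]; exact hpos 1 (by simp)
  · exact hpos t ⟨h0, ht.2⟩

lemma IsPeriodicSol.neg {V : ℝ → ℝ → ℝ} {x : ℝ → ℝ} (hx : IsPeriodicSol V x) :
    IsPeriodicSol (fun y t => -V (-y) t) (fun t => -x t) :=
  ⟨fun t ht => by simpa using (hx.1 t ht).fun_neg, by simp [hx.2]⟩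

lemma IsPeriodicSol.lt_of_exists_ge {V : ℝ → ℝ → ℝ} {x : ℝ → ℝ} {c : ℝ}
    (hx : IsPeriodicSol V x) (hV : ∀ t ∈ Icc (0:ℝ) 1, V c t < 0)
    (h : ∃ s ∈ Icc (0:ℝ) 1, x s ≤ c) : ∀ t ∈ Icc (0:ℝ) 1, x t < c := by
  obtain ⟨s, hs, hxs⟩ := h
  have := hx.neg.lt_of_exists_le (c := -c) (by simpa using hV) ⟨s, hs, by simpa using hxs⟩
  simpa using this

/-- A time-reversed periodic solution solves the time-reversed equation. -/
lemma IsPeriodicSol.reverse {V : ℝ → ℝ → ℝ} {x : ℝ → ℝ}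
    (hx : IsPeriodicSol (fun y t => -V y (1 - t)) x) :
    IsPeriodicSol V (fun t => x (1 - t)) := by
  refine ⟨fun t ht => ?_, by simp [hx.2]⟩
  have ht' : 1 - t ∈ Icc (0:ℝ) 1 := ⟨by linarith [ht.2], by linarith [ht.1]⟩
  have h1 : HasDerivWithinAt (fun t : ℝ => 1 - t) (-1) (Icc (0:ℝ) 1) t := by
    simpa using (hasDerivWithinAt_id t (Icc (0:ℝ) 1)).const_sub 1
  have := (hx.1 _ ht').comp t h1
    (fun s hs => ⟨by linarith [hs.2], by linarith [hs.1]⟩)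
  simpa [Function.comp_def] using this

/-- If the vector field points inwards at both ends of `[a, b]`, there is a periodic solution
with values in `(a, b)`. -/
lemma exists_periodicSol_of_inward {V : ℝ → ℝ → ℝ} {a b : ℝ} {K : ℝ≥0} (hab : a < b)
    (hc : Continuous fun p : ℝ × ℝ => V p.1 p.2)
    (hK : ∀ t ∈ Icc (0:ℝ) 1, LipschitzOnWith K (fun x => V x t) (Icc a b))
    (ha : ∀ t ∈ Icc (0:ℝ) 1, 0 < V a t) (hb : ∀ t ∈ Icc (0:ℝ) 1, V b t < 0) :
    ∃ x : ℝ → ℝ, IsPeriodicSol V x ∧ ∀ t ∈ Icc (0:ℝ) 1, x t ∈ Ioo a b := by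
  obtain ⟨C, hC⟩ := (isCompact_Icc (a := a) (b := b)).prod
    (isCompact_Icc (a := (0:ℝ)) (b := 1)) |>.exists_bound_of_continuousOn hc.continuousOn
  set p : ℝ → ℝ := fun x => max a (min b x) with hp
  have hpm : ∀ x, p x ∈ Icc a b := fun x => ⟨le_max_left _ _, max_le hab.le (min_le_left _ _)⟩
  have hpe : ∀ x ∈ Icc a b, p x = x := fun x hx => by simp [hp, hx.1, hx.2]
  have hpl : LipschitzWith 1 p := (LipschitzWith.id.const_min b).const_max a
  set W : ℝ → ℝ → ℝ := fun x t => V (p x) t with hW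
  let r : ℝ≥0 := ⟨b - a, by linarith⟩
  have hPL : IsPicardLindelof (fun t x => W x t) (tmin := 0) (tmax := 1) ⟨0, by simp⟩ a
      (r + C.toNNReal) r C.toNNReal K :=
    { lipschitzOnWith := fun t ht => by
        have := (hK t ht).comp (hpl.lipschitzOnWith (s := Metric.closedBall a (r + C.toNNReal)))
          (fun x _ => hpm x)
        simpa [hW, Function.comp_def] using this
      continuousOn := fun x _ => (hc.comp (Continuous.prodMk_right (p x))).continuousOn
      norm_le := fun t ht x _ => (hC (p x, t) ⟨hpm x, ht⟩).trans (Real.le_coe_toNNReal C)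
      mul_max_le := by simp }
  obtain ⟨α, hα, L, hL⟩ :=
    hPL.exists_forall_mem_closedBall_eq_hasDerivWithinAt_lipschitzOnWith
  have hball : Icc a b ⊆ Metric.closedBall a r := fun x hx => by
    rw [Metric.mem_closedBall, Real.dist_eq, abs_of_nonneg (by linarith [hx.1])]
    change x - a ≤ b - a
    linarith [hx.2]
  have hWa : ∀ t ∈ Icc (0:ℝ) 1, 0 < W a t := fun t ht => by
    simpa [hW, hpe a ⟨le_rfl, hab.le⟩] using ha t ht
  have hWb : ∀ t ∈ Icc (0:ℝ) 1, W b t < 0 := fun t ht => by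
    simpa [hW, hpe b ⟨hab.le, le_rfl⟩] using hb t ht
  have hma : a ∈ Icc a b := ⟨le_rfl, hab.le⟩
  have hmb : b ∈ Icc a b := ⟨hab.le, le_rfl⟩
  have h1 : a ≤ α a 1 := le_of_vectorField_pos (hα a (hball hma)).2 hWa (s := 0) (by simp)
    (hα a (hball hma)).1.ge 1 (by simp)
  have h2 : α b 1 ≤ b := by
    have := le_of_vectorField_pos (V := fun y t => -W (-y) t) (x := fun t => -α b t) (c := -b)
      (s := 0) (fun t ht => by simpa using ((hα b (hball hmb)).2 t ht).fun_neg)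
      (by simpa using hWb) (by simp) (by simpa using (hα b (hball hmb)).1.le) 1 (by simp)
    simpa using this
  have hcont : ContinuousOn (fun x => α x 1 - x) (Icc a b) :=
    ((hL 1 (by simp)).continuousOn.mono hball).sub continuousOn_id
  obtain ⟨x0, hx0, hfix⟩ := intermediate_value_Icc' hab.le hcont
    (show (0:ℝ) ∈ _ from ⟨by linarith, by linarith⟩)
  obtain ⟨hi, hd⟩ := hα x0 (hball hx0)
  change α x0 0 = x0 at hi
  have hper : IsPeriodicSol W (α x0) := ⟨hd, by simp only at hfix; linarith⟩
  have hlo := hper.lt_of_exists_le hWa ⟨0, by simp, by rw [hi]; exact hx0.1⟩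
  have hhi := hper.lt_of_exists_ge hWb ⟨0, by simp, by rw [hi]; exact hx0.2⟩
  refine ⟨α x0, ⟨fun t ht => ?_, hper.2⟩, fun t ht => ⟨hlo t ht, hhi t ht⟩⟩
  have := hd t ht
  simpa only [hW, hpe _ ⟨(hlo t ht).le, (hhi t ht).le⟩] using this

/-- The vector field `x (x² - 4) + 5 cos(2πt) (x + 1) (x - 1) (x - 3)`. -/
noncomputable def abelField (x t : ℝ) : ℝ :=
  (1 + 5 * Real.cos (2 * Real.pi * t)) * x ^ 3
      - 15 * Real.cos (2 * Real.pi * t) * x ^ 2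
      - (4 + 5 * Real.cos (2 * Real.pi * t)) * x
      + 15 * Real.cos (2 * Real.pi * t)

lemma continuous_abelField : Continuous fun p : ℝ × ℝ => abelField p.1 p.2 := by
  unfold abelField; fun_prop

lemma abelField_neg_one (t : ℝ) : abelField (-1) t = 3 := by unfold abelField; ring

lemma abelField_one (t : ℝ) : abelField 1 t = -3 := by unfold abelField; ring

lemma abelField_three (t : ℝ) : abelField 3 t = 15 := by unfold abelField; ring

/-- The difference quotient of `abelField` in its first variable. -/
noncomputable def abelSlope (x y t : ℝ) : ℝ :=
  (1 + 5 * Real.cos (2 * Real.pi * t)) * (x ^ 2 + x * y + y ^ 2)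
      - 15 * Real.cos (2 * Real.pi * t) * (x + y) - (4 + 5 * Real.cos (2 * Real.pi * t))

lemma abelField_sub (x y t : ℝ) :
    abelField y t - abelField x t = abelSlope x y t * (y - x) := by
  unfold abelField abelSlope; ring

lemma continuous_abelSlope :
    Continuous fun p : ℝ × ℝ × ℝ => abelSlope p.1 p.2.1 p.2.2 := by
  unfold abelSlope; fun_prop

lemma exists_lipschitzOnWith_abelField (a b : ℝ) :
    ∃ K : ℝ≥0, ∀ t ∈ Icc (0:ℝ) 1, LipschitzOnWith K (fun x => abelField x t) (Icc a b) := by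
  obtain ⟨C, hC⟩ := ((isCompact_Icc (a := a) (b := b)).prod
    ((isCompact_Icc (a := a) (b := b)).prod (isCompact_Icc (a := (0:ℝ)) (b := 1))))
    |>.exists_bound_of_continuousOn continuous_abelSlope.continuousOn
  refine ⟨C.toNNReal, fun t ht => LipschitzOnWith.of_dist_le_mul fun x hx y hy => ?_⟩
  rw [Real.dist_eq, Real.dist_eq, abelField_sub, abs_mul]
  exact mul_le_mul_of_nonneg_right ((hC (y, x, t) ⟨hy, hx, ht⟩).trans (Real.le_coe_toNNReal C))
    (abs_nonneg _)

/-- Periodic solutions with ordered initial values stay ordered. -/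
lemma abelField_sol_lt {x y : ℝ → ℝ} (hx : IsPeriodicSol abelField x)
    (hy : IsPeriodicSol abelField y) (h0 : x 0 < y 0) : ∀ t ∈ Icc (0:ℝ) 1, x t < y t := by
  have hxc : ContinuousOn x (Icc 0 1) := fun t ht => (hx.1 t ht).continuousWithinAt
  have hyc : ContinuousOn y (Icc 0 1) := fun t ht => (hy.1 t ht).continuousWithinAt
  obtain ⟨K, hK⟩ := (isCompact_Icc (a := (0:ℝ)) (b := 1)).exists_bound_of_continuousOn
    (continuous_abelSlope.comp_continuousOn (hxc.prodMk (hyc.prodMk continuousOn_id)))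
  have hd : ∀ t ∈ Icc (0:ℝ) 1, HasDerivWithinAt
      (fun t => (y t - x t) ^ 2 * Real.exp (2 * K * t))
      (2 * (y t - x t) ^ 2 * (abelSlope (x t) (y t) t + K) * Real.exp (2 * K * t))
      (Icc 0 1) t := by
    intro t ht
    have h1 := ((hy.1 t ht).sub (hx.1 t ht)).pow 2
    have h2 : HasDerivWithinAt (fun t : ℝ => Real.exp (2 * K * t))
        (Real.exp (2 * K * t) * (2 * K)) (Icc 0 1) t := by
      simpa using (((hasDerivAt_id t).const_mul (2 * K)).exp).hasDerivWithinAt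
    refine (h1.mul h2).congr_deriv ?_
    simp only [Pi.sub_apply, Pi.pow_apply]
    rw [abelField_sub]
    push_cast
    ring
  have hmono : MonotoneOn (fun t => (y t - x t) ^ 2 * Real.exp (2 * K * t)) (Icc 0 1) := by
    refine monotoneOn_of_hasDerivWithinAt_nonneg (convex_Icc 0 1)
      (fun t ht => (hd t ht).continuousWithinAt)
      (fun t ht => (hd t (interior_subset ht)).mono interior_subset) (fun t ht => ?_)
    have := (abs_le.1 (hK t (interior_subset ht))).1
    simp only [Function.comp, id] at this
    have : 0 ≤ abelSlope (x t) (y t) t + K := by linarith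
    positivity
  have hne : ∀ t ∈ Icc (0:ℝ) 1, y t - x t ≠ 0 := by
    intro t ht h
    have := hmono (by simp) ht ht.1
    simp only [h] at this
    have : 0 < (y 0 - x 0) ^ 2 := pow_pos (sub_pos.2 h0) 2
    simp at *
    linarith
  intro t ht
  by_contra hlt
  have hsub : Icc 0 t ⊆ Icc (0:ℝ) 1 := Icc_subset_Icc_right ht.2
  obtain ⟨s, hs, hzs⟩ := intermediate_value_Icc' ht.1 ((hyc.sub hxc).mono hsub)
    (show (0:ℝ) ∈ _ from ⟨by simp only [Pi.sub_apply]; linarith,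
      by simp only [Pi.sub_apply]; linarith⟩)
  exact hne s (hsub hs) hzs

/-- A primitive of `1 / ((x + 1) (x - 1) (x - 3))`. -/
noncomputable def abelPrimitive (x : ℝ) : ℝ :=
  Real.log (x + 1) / 8 - Real.log (x - 1) / 4 + Real.log (x - 3) / 8

/-- The partial fraction expansion of `abelField x t / ((x + 1) (x - 1) (x - 3))`. -/
noncomputable def abelRatio (x t : ℝ) : ℝ :=
  1 + 5 * Real.cos (2 * Real.pi * t) + 3 / 8 / (x + 1) + 3 / 4 / (x - 1) + 15 / 8 / (x - 3)

lemma hasDerivWithinAt_abelPrimitive {x : ℝ → ℝ} {t : ℝ} {s : Set ℝ}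
    (hx : HasDerivWithinAt x (abelField (x t) t) s t)
    (h1 : x t + 1 ≠ 0) (h2 : x t - 1 ≠ 0) (h3 : x t - 3 ≠ 0) :
    HasDerivWithinAt (fun t => abelPrimitive (x t)) (abelRatio (x t) t) s t := by
  have := ((((hx.add_const 1).log h1).div_const 8).sub
    (((hx.sub_const 1).log h2).div_const 4)).add (((hx.sub_const 3).log h3).div_const 8)
  refine this.congr_deriv ?_
  unfold abelRatio abelField
  field_simp
  ring

lemma abelRatio_lt {x y t : ℝ} (h : x < y) (h1 : 0 < (x + 1) * (y + 1))
    (h2 : 0 < (x - 1) * (y - 1)) (h3 : 0 < (x - 3) * (y - 3)) :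
    abelRatio y t < abelRatio x t := by
  have aux : ∀ {c u v : ℝ}, 0 < c → u < v → 0 < u * v → c / v < c / u := by
    intro c u v hc huv h
    have hu : u ≠ 0 := left_ne_zero_of_mul h.ne'
    have hv : v ≠ 0 := right_ne_zero_of_mul h.ne'
    have : c / u - c / v = c * (v - u) / (u * v) := by field_simp
    have : 0 < c / u - c / v := by
      rw [this]; exact div_pos (mul_pos hc (sub_pos.2 huv)) h
    linarith
  have e1 := aux (c := 3 / 8) (by norm_num) (by linarith : x + 1 < y + 1) h1
  have e2 := aux (c := 3 / 4) (by norm_num) (by linarith : x - 1 < y - 1) h2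
  have e3 := aux (c := 15 / 8) (by norm_num) (by linarith : x - 3 < y - 3) h3
  unfold abelRatio
  linarith

/-- Two ordered periodic solutions cannot lie in a common component of the complement of
`{-1, 1, 3}`. -/
lemma abelField_not_lt {x y : ℝ → ℝ} (hx : IsPeriodicSol abelField x)
    (hy : IsPeriodicSol abelField y)
    (h : ∀ t ∈ Icc (0:ℝ) 1, 0 < (x t + 1) * (y t + 1) ∧ 0 < (x t - 1) * (y t - 1) ∧
      0 < (x t - 3) * (y t - 3)) : ¬ x 0 < y 0 := by
  intro h0
  have hlt := abelField_sol_lt hx hy h0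
  have hd : ∀ t ∈ Icc (0:ℝ) 1, HasDerivWithinAt
      (fun t => abelPrimitive (x t) - abelPrimitive (y t))
      (abelRatio (x t) t - abelRatio (y t) t) (Icc 0 1) t := by
    intro t ht
    obtain ⟨h1, h2, h3⟩ := h t ht
    exact (hasDerivWithinAt_abelPrimitive (hx.1 t ht) (left_ne_zero_of_mul h1.ne')
      (left_ne_zero_of_mul h2.ne') (left_ne_zero_of_mul h3.ne')).sub
      (hasDerivWithinAt_abelPrimitive (hy.1 t ht) (right_ne_zero_of_mul h1.ne')
      (right_ne_zero_of_mul h2.ne') (right_ne_zero_of_mul h3.ne'))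
  have hmono := strictMonoOn_of_hasDerivWithinAt_pos (convex_Icc (0:ℝ) 1)
    (fun t ht => (hd t ht).continuousWithinAt)
    (fun t ht => (hd t (interior_subset ht)).mono interior_subset)
    (fun t ht => by
      obtain ⟨h1, h2, h3⟩ := h t (interior_subset ht)
      exact sub_pos.2 (abelRatio_lt (hlt t (interior_subset ht)) h1 h2 h3))
  have := hmono (show (0:ℝ) ∈ _ by simp) (show (1:ℝ) ∈ _ by simp) one_pos
  simp [hx.2, hy.2] at this

/-- There is no periodic solution above `3`. -/
lemma abelField_not_three_lt {x : ℝ → ℝ} (hx : IsPeriodicSol abelField x) :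
    ¬ ∀ t ∈ Icc (0:ℝ) 1, 3 < x t := by
  intro h
  have hd : ∀ t ∈ Icc (0:ℝ) 1, HasDerivWithinAt
      (fun t => abelPrimitive (x t) - 5 * (Real.sin (2 * Real.pi * t) / (2 * Real.pi)) - t)
      (abelRatio (x t) t - 5 * Real.cos (2 * Real.pi * t) - 1) (Icc 0 1) t := by
    intro t ht
    have h3 := h t ht
    have hs : HasDerivAt (fun t => Real.sin (2 * Real.pi * t) / (2 * Real.pi))
        (Real.cos (2 * Real.pi * t)) t := by
      have := (((hasDerivAt_id t).const_mul (2 * Real.pi)).sin).div_const (2 * Real.pi)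
      refine this.congr_deriv ?_
      have := Real.pi_ne_zero
      simp only [id]
      field_simp
    exact ((hasDerivWithinAt_abelPrimitive (hx.1 t ht) (by linarith) (by linarith)
      (by linarith)).sub (hs.const_mul 5).hasDerivWithinAt).sub (hasDerivWithinAt_id t _)
  have hmono := strictMonoOn_of_hasDerivWithinAt_pos (convex_Icc (0:ℝ) 1)
    (fun t ht => (hd t ht).continuousWithinAt)
    (fun t ht => (hd t (interior_subset ht)).mono interior_subset)
    (fun t ht => by
      have h3 := h t (interior_subset ht)
      have e1 : 0 < 3 / 8 / (x t + 1) := div_pos (by norm_num) (by linarith)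
      have e2 : 0 < 3 / 4 / (x t - 1) := div_pos (by norm_num) (by linarith)
      have e3 : 0 < 15 / 8 / (x t - 3) := div_pos (by norm_num) (by linarith)
      unfold abelRatio
      linarith)
  have := hmono (show (0:ℝ) ∈ _ by simp) (show (1:ℝ) ∈ _ by simp) one_pos
  simp [hx.2] at this
  linarith

/-- Every periodic solution lies in `(-∞, -1)`, `(-1, 1)` or `(1, 3)`. -/
lemma abelField_trichotomy {x : ℝ → ℝ} (hx : IsPeriodicSol abelField x) :
    (∀ t ∈ Icc (0:ℝ) 1, x t < -1) ∨ (∀ t ∈ Icc (0:ℝ) 1, x t ∈ Ioo (-1:ℝ) 1) ∨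
      ∀ t ∈ Icc (0:ℝ) 1, x t ∈ Ioo (1:ℝ) 3 := by
  by_cases h1 : ∃ s ∈ Icc (0:ℝ) 1, -1 ≤ x s
  · have hm := hx.lt_of_exists_le (fun t _ => by rw [abelField_neg_one]; norm_num) h1
    by_cases h2 : ∃ s ∈ Icc (0:ℝ) 1, x s ≤ 1
    · have hl := hx.lt_of_exists_ge (fun t _ => by rw [abelField_one]; norm_num) h2
      exact Or.inr (Or.inl fun t ht => ⟨hm t ht, hl t ht⟩)
    · push Not at h2
      by_cases h3 : ∃ s ∈ Icc (0:ℝ) 1, 3 ≤ x s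
      · exact absurd (hx.lt_of_exists_le (fun t _ => by rw [abelField_three]; norm_num) h3)
          (abelField_not_three_lt hx)
      · push Not at h3
        exact Or.inr (Or.inr fun t ht => ⟨h2 t ht, h3 t ht⟩)
  · push Not at h1
    exact Or.inl h1

/-- Initial values of periodic solutions with values in `I` form a subset of a singleton, if
`I` meets a single component of the complement of `{-1, 1, 3}`. -/
lemma exists_abelField_initial_eq (I : Set ℝ)
    (hI : ∀ u ∈ I, ∀ v ∈ I, 0 < (u + 1) * (v + 1) ∧ 0 < (u - 1) * (v - 1) ∧
      0 < (u - 3) * (v - 3)) :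
    ∃ c : ℝ, ∀ x : ℝ → ℝ, IsPeriodicSol abelField x → (∀ t ∈ Icc (0:ℝ) 1, x t ∈ I) →
      x 0 = c := by
  by_cases h : ∃ y : ℝ → ℝ, IsPeriodicSol abelField y ∧ ∀ t ∈ Icc (0:ℝ) 1, y t ∈ I
  · obtain ⟨y, hy, hyI⟩ := h
    refine ⟨y 0, fun x hx hxI => le_antisymm ?_ ?_⟩
    · exact not_lt.1 (abelField_not_lt hy hx fun t ht => hI _ (hyI t ht) _ (hxI t ht))
    · exact not_lt.1 (abelField_not_lt hx hy fun t ht => hI _ (hxI t ht) _ (hyI t ht))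
  · exact ⟨0, fun x hx hxI => absurd ⟨x, hx, hxI⟩ h⟩

lemma exists_finset_abelField_initial : ∃ F : Finset ℝ, F.card ≤ 3 ∧
    ∀ x : ℝ → ℝ, IsPeriodicSol abelField x → x 0 ∈ F := by
  obtain ⟨c₁, h₁⟩ := exists_abelField_initial_eq (Iio (-1)) (by
    intro u hu v hv
    simp only [mem_Iio] at hu hv
    exact ⟨mul_pos_of_neg_of_neg (by linarith) (by linarith),
      mul_pos_of_neg_of_neg (by linarith) (by linarith),
      mul_pos_of_neg_of_neg (by linarith) (by linarith)⟩)
  obtain ⟨c₂, h₂⟩ := exists_abelField_initial_eq (Ioo (-1) 1) (by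
    rintro u ⟨hu, hu'⟩ v ⟨hv, hv'⟩
    exact ⟨mul_pos (by linarith) (by linarith),
      mul_pos_of_neg_of_neg (by linarith) (by linarith),
      mul_pos_of_neg_of_neg (by linarith) (by linarith)⟩)
  obtain ⟨c₃, h₃⟩ := exists_abelField_initial_eq (Ioo 1 3) (by
    rintro u ⟨hu, hu'⟩ v ⟨hv, hv'⟩
    exact ⟨mul_pos (by linarith) (by linarith), mul_pos (by linarith) (by linarith),
      mul_pos_of_neg_of_neg (by linarith) (by linarith)⟩)
  refine ⟨{c₁, c₂, c₃}, Finset.card_le_three, fun x hx => ?_⟩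
  rcases abelField_trichotomy hx with h | h | h
  · simp [h₁ x hx h]
  · simp [h₂ x hx h]
  · simp [h₃ x hx h]

lemma hypH_abelField : HypH 3 abelField := by
  refine ⟨fun i => 2 * i - 3, fun i j _ hij _ => ?_, Or.inr fun i h1 h3 t _ => ?_⟩
  · have : (i : ℝ) < j := by exact_mod_cast hij
    simp only
    linarith
  · interval_cases i
    · norm_num [abelField_neg_one]
    · norm_num [abelField_one]
    · norm_num [abelField_three]

lemma exists_periodicSol_abelField_Ioo_one_three :
    ∃ x : ℝ → ℝ, IsPeriodicSol abelField x ∧ ∀ t ∈ Icc (0:ℝ) 1, x t ∈ Ioo (1:ℝ) 3 := by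
  obtain ⟨K, hK⟩ := exists_lipschitzOnWith_abelField 1 3
  have hflip : ∀ t ∈ Icc (0:ℝ) 1, 1 - t ∈ Icc (0:ℝ) 1 :=
    fun t ht => ⟨by linarith [ht.2], by linarith [ht.1]⟩
  obtain ⟨x, hx, hmem⟩ := exists_periodicSol_of_inward
    (V := fun y t => -abelField y (1 - t)) (a := 1) (b := 3) (K := K) (by norm_num)
    (continuous_abelField.comp
      (continuous_fst.prodMk (continuous_const.sub continuous_snd))).neg
    (fun t ht => (hK (1 - t) (hflip t ht)).neg)
    (fun t _ => by rw [abelField_one]; norm_num)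
    (fun t _ => by rw [abelField_three]; norm_num)
  exact ⟨_, hx.reverse, fun t ht => hmem _ (hflip t ht)⟩

/-- The concrete Abel equation (17): `S(-1,t) = 3`, `S(1,t) = -3`, `S(3,t) = 15`, so (H)
holds with `λ₁ = -1, λ₂ = 1, λ₃ = 3`; hence there are at most `3` isolated periodic
solutions, and there are periodic solutions in `(-1,1)` and in `(1,3)`. -/
theorem abel_example17 (S : ℝ → ℝ → ℝ)
    (hS : ∀ x t, S x t = (1 + 5 * Real.cos (2 * Real.pi * t)) * x ^ 3
      - 15 * Real.cos (2 * Real.pi * t) * x ^ 2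
      - (4 + 5 * Real.cos (2 * Real.pi * t)) * x
      + 15 * Real.cos (2 * Real.pi * t)) :
    (∀ t : ℝ, S (-1) t = 3) ∧ (∀ t : ℝ, S 1 t = -3) ∧ (∀ t : ℝ, S 3 t = 15) ∧
    HypH 3 S ∧
    (∃ F : Finset ℝ, F.card ≤ 3 ∧
      {x0 : ℝ | ∃ x : ℝ → ℝ, IsIsolatedPeriodicSol S x ∧ x 0 = x0} ⊆ (F : Set ℝ)) ∧
    (∃ x : ℝ → ℝ, IsPeriodicSol S x ∧ ∀ t ∈ Set.Icc (0:ℝ) 1, x t ∈ Set.Ioo (-1:ℝ) 1) ∧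
    (∃ x : ℝ → ℝ, IsPeriodicSol S x ∧ ∀ t ∈ Set.Icc (0:ℝ) 1, x t ∈ Set.Ioo (1:ℝ) 3) := by
  obtain rfl : S = abelField := by
    funext x t
    exact hS x t
  refine ⟨abelField_neg_one, abelField_one, abelField_three, hypH_abelField, ?_, ?_,
    exists_periodicSol_abelField_Ioo_one_three⟩
  · obtain ⟨F, hF, h⟩ := exists_finset_abelField_initial
    refine ⟨F, hF, ?_⟩
    rintro _ ⟨x, hx, rfl⟩
    exact h x hx.1
  · obtain ⟨K, hK⟩ := exists_lipschitzOnWith_abelField (-1) 1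
    exact exists_periodicSol_of_inward (by norm_num) continuous_abelField hK
      (fun t _ => by rw [abelField_neg_one]; norm_num)
      (fun t _ => by rw [abelField_one]; norm_num)
end
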